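/- arXiv:1806.09361 — 7 statements merged into one kernel-verified Lean document; each statement's English description precedes it below -/
import Mathlib

section
/- Let H be a complex Hilbert space and let x and y be unit vectors in H. Then there exists a surjective linear isometry R : H → H (a bounded linear bijection preserving the norm) such that R x = y and ‖R − Id_H‖ = ‖x − y‖. -/
open ContinuousLinearMap

theorem norm_sq_add_add_of_orthonormal {H : Type*} [NormedAddCommGroup H] [InnerProductSpace ℂ H]
    {x u v : H} (hx : ‖x‖ = 1) (hu : ‖u‖ = 1) (hxu : inner ℂ x u = 0)
    (hxv : inner ℂ x v = 0) (huv : inner ℂ u v = 0) (p q : ℂ) :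
    ‖p • x + q • u + v‖ ^ 2 = ‖p‖ ^ 2 + ‖q‖ ^ 2 + ‖v‖ ^ 2 := by
  have h1 : inner ℂ (p • x + q • u) v = 0 := by
    simp [hxv, huv]
  have h2 : inner ℂ (p • x) (q • u) = 0 := by
    simp [hxu]
  have e1 := norm_add_sq_eq_norm_sq_add_norm_sq_of_inner_eq_zero _ _ h1
  have e2 := norm_add_sq_eq_norm_sq_add_norm_sq_of_inner_eq_zero _ _ h2
  rw [norm_smul, norm_smul, hx, hu] at e2
  linarith

/-- The operator acting on the span of the orthonormal pair `x, u` by the matrix with columns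
`(a, b)` and `(-b, conj a)`, and as the identity on the orthogonal complement. -/
noncomputable def planeRotation {H : Type*} [NormedAddCommGroup H] [InnerProductSpace ℂ H]
    (x u : H) (a : ℂ) (b : ℝ) : H →L[ℂ] H :=
  1 + (innerSL ℂ x).smulRight ((a - 1) • x + (b : ℂ) • u) +
    (innerSL ℂ u).smulRight (-(b : ℂ) • x + (starRingEnd ℂ a - 1) • u)

section PlaneRotation

variable {H : Type*} [NormedAddCommGroup H] [InnerProductSpace ℂ H]
  {x u v : H}

theorem planeRotation_apply (hx : ‖x‖ = 1) (hu : ‖u‖ = 1) (hxu : inner ℂ x u = 0)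
    (hxv : inner ℂ x v = 0) (huv : inner ℂ u v = 0) (a : ℂ) (b : ℝ) (p q : ℂ) :
    planeRotation x u a b (p • x + q • u + v) =
      (a * p - b * q) • x + (b * p + starRingEnd ℂ a * q) • u + v := by
  have hux : inner ℂ u x = 0 := inner_eq_zero_symm.mp hxu
  simp only [planeRotation, add_apply, one_apply_eq_self, smulRight_apply, innerSL_apply_apply,
    inner_add_right, inner_smul_right, inner_self_eq_norm_sq_to_K, hx, hu, hxu, hux, hxv, huv]
  simp only [Complex.coe_algebraMap, Complex.ofReal_one]
  module

theorem exists_orthogonal_decomposition (hx : ‖x‖ = 1) (hu : ‖u‖ = 1) (hxu : inner ℂ x u = 0)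
    (z : H) : ∃ (p q : ℂ) (v : H), inner ℂ x v = 0 ∧ inner ℂ u v = 0 ∧
      z = p • x + q • u + v := by
  have hux : inner ℂ u x = 0 := inner_eq_zero_symm.mp hxu
  refine ⟨inner ℂ x z, inner ℂ u z, z - (inner ℂ x z • x + inner ℂ u z • u), ?_, ?_, by abel⟩ <;>
  simp [inner_self_eq_norm_sq_to_K, hx, hu,
    hxu, hux]

theorem planeRotation_surjective (hx : ‖x‖ = 1) (hu : ‖u‖ = 1) (hxu : inner ℂ x u = 0)
    {a : ℂ} {b : ℝ} (hab : ‖a‖ ^ 2 + b ^ 2 = 1) :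
    Function.Surjective (planeRotation x u a b) := by
  intro z
  obtain ⟨p, q, v, hxv, huv, rfl⟩ := exists_orthogonal_decomposition hx hu hxu z
  have h : a * starRingEnd ℂ a + (b : ℂ) ^ 2 = 1 := by
    rw [Complex.mul_conj']
    exact_mod_cast hab
  refine ⟨(starRingEnd ℂ a * p + b * q) • x + (-b * p + a * q) • u + v, ?_⟩
  rw [planeRotation_apply hx hu hxu hxv huv]
  congr 3
  · linear_combination p * h
  · linear_combination q * h

theorem norm_planeRotation_apply (hx : ‖x‖ = 1) (hu : ‖u‖ = 1) (hxu : inner ℂ x u = 0)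
    {a : ℂ} {b : ℝ} (hab : ‖a‖ ^ 2 + b ^ 2 = 1) (z : H) :
    ‖planeRotation x u a b z‖ = ‖z‖ := by
  obtain ⟨p, q, v, hxv, huv, rfl⟩ := exists_orthogonal_decomposition hx hu hxu z
  rw [← sq_eq_sq₀ (norm_nonneg _) (norm_nonneg _), planeRotation_apply hx hu hxu hxv huv,
    norm_sq_add_add_of_orthonormal hx hu hxu hxv huv,
    norm_sq_add_add_of_orthonormal hx hu hxu hxv huv]
  simp only [Complex.sq_norm, Complex.normSq_apply] at hab ⊢
  simp
  linear_combination (p.re * p.re + p.im * p.im + q.re * q.re + q.im * q.im) * hab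

theorem norm_planeRotation_sub_one_le (hx : ‖x‖ = 1) (hu : ‖u‖ = 1) (hxu : inner ℂ x u = 0)
    (a : ℂ) (b : ℝ) :
    ‖planeRotation x u a b - 1‖ ≤ ‖x - (a • x + (b : ℂ) • u)‖ := by
  refine opNorm_le_bound _ (norm_nonneg _) fun z => ?_
  obtain ⟨p, q, v, hxv, huv, rfl⟩ := exists_orthogonal_decomposition hx hu hxu z
  rw [← sq_le_sq₀ (norm_nonneg _) (by positivity), mul_pow, sub_apply, one_apply_eq_self,
    planeRotation_apply hx hu hxu hxv huv,
    norm_sq_add_add_of_orthonormal hx hu hxu hxv huv,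
    show x - (a • x + (b : ℂ) • u) = (1 - a) • x + (-b : ℂ) • u + 0 by module,
    norm_sq_add_add_of_orthonormal hx hu hxu (inner_zero_right _) (inner_zero_right _),
    show (a * p - b * q) • x + (b * p + starRingEnd ℂ a * q) • u + v - (p • x + q • u + v) =
      ((a - 1) * p - b * q) • x + (b * p + (starRingEnd ℂ a - 1) * q) • u + 0 by module,
    norm_sq_add_add_of_orthonormal hx hu hxu (inner_zero_right _) (inner_zero_right _)]
  have hv : 0 ≤ (‖1 - a‖ ^ 2 + ‖(-b : ℂ)‖ ^ 2) * ‖v‖ ^ 2 := by positivity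
  simp only [Complex.sq_norm, Complex.normSq_apply] at hv ⊢
  simp at hv ⊢
  linarith

end PlaneRotation

theorem stmt0 {H : Type*} [NormedAddCommGroup H] [InnerProductSpace ℂ H] [CompleteSpace H]
    (x y : H) (hx : ‖x‖ = 1) (hy : ‖y‖ = 1) :
    ∃ R : H →L[ℂ] H, Function.Surjective R ∧ (∀ z : H, ‖R z‖ = ‖z‖) ∧
      R x = y ∧ ‖R - 1‖ = ‖x - y‖ := by
  suffices h : ∃ R : H →L[ℂ] H, Function.Surjective R ∧ (∀ z : H, ‖R z‖ = ‖z‖) ∧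
      R x = y ∧ ‖R - 1‖ ≤ ‖x - y‖ by
    obtain ⟨R, hR, hiso, hxy, hle⟩ := h
    refine ⟨R, hR, hiso, hxy, hle.antisymm ?_⟩
    simpa [hx, hxy, norm_sub_rev] using (R - 1).le_opNorm x
  set a : ℂ := inner ℂ x y
  by_cases hw : y - a • x = 0
  · have hya : y = a • x := sub_eq_zero.mp hw
    have ha : ‖a‖ = 1 := by simpa [hya, norm_smul, hx] using hy
    have ha0 : a ≠ 0 := by simp [← norm_ne_zero_iff, ha]
    refine ⟨a • 1, fun z => ⟨a⁻¹ • z, by simp [ha0]⟩, fun z => by simp [norm_smul, ha],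
      by simp [hya], opNorm_le_bound _ (norm_nonneg _) fun z => le_of_eq ?_⟩
    rw [hya, sub_apply, smul_apply, one_apply_eq_self, show a • z - z = (a - 1) • z by module,
      show x - a • x = (1 - a) • x by module, norm_smul, norm_smul, hx, mul_one, norm_sub_rev]
  · set b : ℝ := ‖y - a • x‖
    have hb : (b : ℂ) ≠ 0 := by simpa [b] using hw
    set u : H := (b : ℂ)⁻¹ • (y - a • x)
    have hu : ‖u‖ = 1 := norm_smul_inv_norm hw
    have hxu : inner ℂ x u = 0 := by
      simp [u, a, inner_self_eq_norm_sq_to_K, hx]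
    have hyab : y = a • x + (b : ℂ) • u := by simp [u, hb]
    have hab : ‖a‖ ^ 2 + b ^ 2 = 1 := by
      have := norm_sq_add_add_of_orthonormal hx hu hxu (inner_zero_right _) (inner_zero_right _)
        a b
      rw [add_zero, ← hyab, hy] at this
      simpa using this.symm
    refine ⟨planeRotation x u a b, planeRotation_surjective hx hu hxu hab,
      norm_planeRotation_apply hx hu hxu hab, ?_, ?_⟩
    · have := planeRotation_apply hx hu hxu (inner_zero_right x) (inner_zero_right u) a b 1 0
      rw [one_smul, zero_smul, add_zero, add_zero] at this
      simpa only [mul_one, mul_zero, sub_zero, add_zero, ← hyab] using this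
    · exact (norm_planeRotation_sub_one_le hx hu hxu a b).trans_eq (by rw [← hyab])
end

section
/- Let H be a complex Hilbert space and let A be a set of bounded linear operators on H which is invariant under conjugation by surjective linear isometries, i.e., R* ∘ T ∘ R ∈ A whenever T ∈ A and R : H → H is a surjective linear isometry. Suppose H has the BPBp for A: for every ε > 0 there exists η > 0 such that whenever T ∈ A with ‖T‖ = 1 and a unit vector x₀ ∈ H satisfy ‖T x₀‖ > 1 − η, there exist S ∈ A with ‖S‖ = 1 and a unit vector x₁ ∈ H with ‖S x₁‖ = 1, ‖x₁ − x₀‖ < ε, and ‖S − T‖ < ε. Then H has the BPBpp for A: for every ε > 0 there exists η > 0 such that whenever T ∈ A with ‖T‖ = 1 and a unit vector x₀ ∈ H satisfy ‖T x₀‖ > 1 − η, there exists S ∈ A with ‖S‖ = 1, ‖S x₀‖ = 1, and ‖S − T‖ < ε. -/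
open ContinuousLinearMap

/-- The operator `y ↦ y - c ⟪w, y⟫ w`, a complex version of a Householder reflection. -/
noncomputable def householder {H : Type*} [NormedAddCommGroup H] [InnerProductSpace ℂ H]
    (c : ℂ) (w : H) : H →L[ℂ] H :=
  1 - c • InnerProductSpace.rankOne ℂ w w

lemma householder_apply {H : Type*} [NormedAddCommGroup H] [InnerProductSpace ℂ H]
    (c : ℂ) (w y : H) : householder c w y = y - (c * inner ℂ w y) • w := by
  simp [householder, mul_smul]

lemma householder_mul_householder {H : Type*} [NormedAddCommGroup H] [InnerProductSpace ℂ H]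
    {c c' : ℂ} {w : H} (h : c + c' = c * c' * inner ℂ w w) :
    householder c w * householder c' w = 1 := by
  ext y
  rw [mul_apply_eq_comp, householder_apply, householder_apply, inner_sub_right, inner_smul_right, one_apply_eq_self,
    sub_sub, ← add_smul]
  convert sub_zero y using 2
  rw [show c' * inner ℂ w y + c * (inner ℂ w y - c' * inner ℂ w y * inner ℂ w w) = 0 by
    linear_combination (inner ℂ w y) * h, zero_smul]

lemma householder_mem_unitary {H : Type*} [NormedAddCommGroup H] [InnerProductSpace ℂ H]
    [CompleteSpace H] {c : ℂ} {w : H}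
    (h : c + starRingEnd ℂ c = c * starRingEnd ℂ c * inner ℂ w w) :
    householder c w ∈ unitary (H →L[ℂ] H) := by
  have hs : star (householder c w) = householder (starRingEnd ℂ c) w := by
    rw [star_eq_adjoint]
    symm
    rw [eq_adjoint_iff]
    intro x y
    simp only [householder_apply, inner_sub_left, inner_sub_right, inner_smul_left,
      inner_smul_right, map_mul, Complex.conj_conj, inner_conj_symm]
    ring
  rw [Unitary.mem_iff, hs]
  exact ⟨householder_mul_householder (by linear_combination h), householder_mul_householder h⟩

/-- Close unit vectors are related by a unitary operator close to the identity. -/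
lemma exists_unitary_apply_eq_norm_sub_one_le {H : Type*} [NormedAddCommGroup H]
    [InnerProductSpace ℂ H] [CompleteSpace H] {x₀ x₁ : H} (h₀ : ‖x₀‖ = 1) (h₁ : ‖x₁‖ = 1)
    (h : ‖x₁ - x₀‖ ≤ 1) :
    ∃ R ∈ unitary (H →L[ℂ] H), R x₀ = x₁ ∧ ‖R - 1‖ ≤ 7 * ‖x₁ - x₀‖ := by
  have i₀ : inner ℂ x₀ x₀ = 1 := by simp [inner_self_eq_norm_sq_to_K, h₀]
  have i₁ : inner ℂ x₁ x₁ = 1 := by simp [inner_self_eq_norm_sq_to_K, h₁]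
  obtain ⟨d, rfl⟩ : ∃ d, x₁ = x₀ + d := ⟨x₁ - x₀, by abel⟩
  rw [add_sub_cancel_left] at h ⊢
  set w := x₀ + (x₀ + d) with hw
  set α : ℂ := inner ℂ w x₀ with hα
  have hαd : α = 2 + inner ℂ d x₀ := by
    simp only [hα, hw, inner_add_left, i₀]; ring
  have hdx : ‖(inner ℂ d x₀ : ℂ)‖ ≤ ‖d‖ := by simpa [h₀] using norm_inner_le_norm (𝕜 := ℂ) d x₀
  have hα1 : 1 ≤ ‖α‖ := by
    have := norm_sub_norm_le (2 : ℂ) (-inner ℂ d x₀)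
    rw [sub_neg_eq_add, ← hαd, norm_neg] at this
    norm_num at this
    linarith
  have hα0 : α ≠ 0 := norm_pos_iff.mp (by linarith)
  have hα0' : starRingEnd ℂ α ≠ 0 := by simpa using hα0
  have hww : inner ℂ w w = α + starRingEnd ℂ α := by
    rw [hα, inner_conj_symm, hw]
    simp only [inner_add_left, inner_add_right, i₀] at i₁ ⊢
    linear_combination i₁
  have hV : householder 2 x₀ ∈ unitary (H →L[ℂ] H) :=
    householder_mem_unitary (by rw [i₀, Complex.conj_ofNat]; norm_num)
  have hVV : householder 2 x₀ * householder 2 x₀ = 1 :=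
    householder_mul_householder (by rw [i₀]; norm_num)
  have hW : householder α⁻¹ w ∈ unitary (H →L[ℂ] H) :=
    householder_mem_unitary (by rw [hww, map_inv₀]; field_simp; ring)
  refine ⟨householder α⁻¹ w * householder 2 x₀, mul_mem hW hV, ?_, ?_⟩
  · have : householder 2 x₀ x₀ = -x₀ := by
      rw [householder_apply, i₀, mul_one, two_smul]; abel
    rw [mul_apply_eq_comp, this, map_neg, householder_apply, ← hα, inv_mul_cancel₀ hα0, one_smul, hw]
    abel
  · rw [← hVV, ← sub_mul, CStarRing.norm_mul_mem_unitary _ hV]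
    refine opNorm_le_bound _ (by positivity) fun y => ?_
    have key : α • ((householder α⁻¹ w - householder 2 x₀) y) =
        (2 * inner ℂ d x₀ * inner ℂ x₀ y) • x₀ - (2 * inner ℂ d y) • x₀
          - (2 * inner ℂ x₀ y) • d - (inner ℂ d y : ℂ) • d := by
      have e : (householder α⁻¹ w - householder 2 x₀) y =
          (2 * inner ℂ x₀ y) • x₀ - (α⁻¹ * inner ℂ w y) • w := by
        rw [sub_apply, householder_apply, householder_apply]; abel
      rw [e, smul_sub, smul_smul, smul_smul, mul_inv_cancel_left₀ hα0, hαd, hw]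
      simp only [inner_add_left]
      module
    have b₀ : ‖(inner ℂ x₀ y : ℂ)‖ ≤ ‖y‖ := by simpa [h₀] using norm_inner_le_norm (𝕜 := ℂ) x₀ y
    have bd : ‖(inner ℂ d y : ℂ)‖ ≤ ‖d‖ * ‖y‖ := norm_inner_le_norm d y
    calc ‖(householder α⁻¹ w - householder 2 x₀) y‖
        ≤ ‖α‖ * ‖(householder α⁻¹ w - householder 2 x₀) y‖ :=
          le_mul_of_one_le_left (norm_nonneg _) hα1
      _ = ‖α • ((householder α⁻¹ w - householder 2 x₀) y)‖ := (norm_smul _ _).symm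
      _ ≤ ‖(2 * inner ℂ d x₀ * inner ℂ x₀ y) • x₀‖ + ‖(2 * inner ℂ d y) • x₀‖
          + ‖(2 * inner ℂ x₀ y) • d‖ + ‖(inner ℂ d y : ℂ) • d‖ := by
          rw [key]
          refine (norm_sub_le _ _).trans (add_le_add_left ?_ _)
          refine (norm_sub_le _ _).trans (add_le_add_left ?_ _)
          exact norm_sub_le _ _
      _ ≤ 2 * ‖d‖ * ‖y‖ + 2 * (‖d‖ * ‖y‖) + 2 * ‖y‖ * ‖d‖ + ‖d‖ * ‖y‖ * 1 := by
          simp only [norm_smul, norm_mul, h₀, mul_one, Complex.norm_ofNat]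
          refine add_le_add (by gcongr) ?_
          simpa only [mul_one] using mul_le_mul bd h (norm_nonneg _) (by positivity)
      _ = 7 * ‖d‖ * ‖y‖ := by ring

lemma norm_star_mul_mul_sub_le {E : Type*} [NormedRing E] [StarRing E] [CStarRing E] {R : E}
    (hR : R ∈ unitary E) (S : E) : ‖star R * S * R - S‖ ≤ 2 * ‖R - 1‖ * ‖S‖ := by
  have e : star R * S * R - S = star R * (S * (R - 1) - (R - 1) * S) := by
    have : S = star R * R * S := by rw [Unitary.star_mul_self_of_mem hR, one_mul]
    conv_lhs => rw [sub_eq_add_neg]; arg 2; rw [this]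
    noncomm_ring
  rw [e, CStarRing.norm_mem_unitary_mul _ (Unitary.star_mem hR)]
  calc _ ≤ ‖S‖ * ‖R - 1‖ + ‖R - 1‖ * ‖S‖ :=
        (norm_sub_le _ _).trans (add_le_add (norm_mul_le _ _) (norm_mul_le _ _))
    _ = _ := by ring

theorem stmt2 {H : Type*} [NormedAddCommGroup H] [InnerProductSpace ℂ H] [CompleteSpace H]
    (A : Set (H →L[ℂ] H))
    (hA : ∀ T ∈ A, ∀ R : H →L[ℂ] H, Function.Surjective R → (∀ z : H, ‖R z‖ = ‖z‖) →
      adjoint R ∘L T ∘L R ∈ A)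
    (hBPBp : ∀ ε > (0 : ℝ), ∃ η > (0 : ℝ), ∀ T ∈ A, ‖T‖ = 1 →
      ∀ x₀ : H, ‖x₀‖ = 1 → ‖T x₀‖ > 1 - η →
      ∃ S ∈ A, ∃ x₁ : H, ‖S‖ = 1 ∧ ‖x₁‖ = 1 ∧ ‖S x₁‖ = 1 ∧
        ‖x₁ - x₀‖ < ε ∧ ‖S - T‖ < ε) :
    ∀ ε > (0 : ℝ), ∃ η > (0 : ℝ), ∀ T ∈ A, ‖T‖ = 1 →
      ∀ x₀ : H, ‖x₀‖ = 1 → ‖T x₀‖ > 1 - η →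
      ∃ S ∈ A, ‖S‖ = 1 ∧ ‖S x₀‖ = 1 ∧ ‖S - T‖ < ε := by
  intro ε hε
  obtain ⟨η, hη, h⟩ := hBPBp (min 1 (ε / 15)) (by positivity)
  refine ⟨η, hη, fun T hT hT1 x₀ hx₀ hTx₀ => ?_⟩
  obtain ⟨S, hS, x₁, hS1, hx₁, hSx₁, hd, hST⟩ := h T hT hT1 x₀ hx₀ hTx₀
  rw [lt_min_iff] at hd hST
  obtain ⟨R, hR, hRx, hR1⟩ := exists_unitary_apply_eq_norm_sub_one_le hx₀ hx₁ hd.1.le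
  have hR' := Unitary.star_mem hR
  have hsurj : Function.Surjective R := fun y =>
    ⟨star R y, by rw [← mul_apply_eq_comp, Unitary.mul_star_self_of_mem hR, one_apply_eq_self]⟩
  have e : adjoint R ∘L S ∘L R = star R * S * R := by
    rw [mul_assoc]; rfl
  refine ⟨star R * S * R, e ▸ hA S hS R hsurj (norm_map_of_mem_unitary hR), ?_, ?_, ?_⟩
  · rw [CStarRing.norm_mul_mem_unitary _ hR, CStarRing.norm_mem_unitary_mul _ hR', hS1]
  · rw [mul_apply_eq_comp, mul_apply_eq_comp, hRx, norm_map_of_mem_unitary hR', hSx₁]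
  · have hb := norm_star_mul_mul_sub_le hR S
    have ht := norm_sub_le_norm_sub_add_norm_sub (star R * S * R) S T
    rw [hS1] at hb
    linarith [hd.2, hST.2]
end

section
/- Every complex Hilbert space H has the Bishop-Phelps-Bollobás point property for bounded linear operators: for every ε > 0 there exists η > 0 such that whenever T is a bounded linear operator on H with ‖T‖ = 1 and x₀ ∈ H is a unit vector satisfying ‖T x₀‖ > 1 − η, there exists a bounded linear operator S on H with ‖S‖ = 1, ‖S x₀‖ = 1, and ‖S − T‖ < ε. -/
open ContinuousLinearMap

section

variable {H : Type*} [NormedAddCommGroup H] [InnerProductSpace ℂ H]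

theorem inner_sub_inner_smul_self {v : H} (hv : ‖v‖ = 1) (z : H) :
    inner ℂ v (z - inner ℂ v z • v) = 0 := by
  rw [inner_sub_right, inner_smul_right, inner_self_eq_norm_sq_to_K, hv]
  simp

theorem norm_smul_add_sq_of_inner_eq_zero {v w : H} (hv : ‖v‖ = 1) (h : inner ℂ v w = 0) (a : ℂ) :
    ‖a • v + w‖ ^ 2 = ‖a‖ ^ 2 + ‖w‖ ^ 2 := by
  have := norm_add_sq_eq_norm_sq_add_norm_sq_of_inner_eq_zero (𝕜 := ℂ) (a • v) w
    (by rw [inner_smul_left, h, mul_zero])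
  rw [norm_smul, hv, mul_one] at this
  linarith

theorem norm_sq_eq_norm_inner_sq_add {v : H} (hv : ‖v‖ = 1) (z : H) :
    ‖z‖ ^ 2 = ‖inner ℂ v z‖ ^ 2 + ‖z - inner ℂ v z • v‖ ^ 2 := by
  rw [← norm_smul_add_sq_of_inner_eq_zero hv (inner_sub_inner_smul_self hv z), add_sub_cancel]

theorem norm_adjoint_apply_apply_sub_sq_le [CompleteSpace H] {T : H →L[ℂ] H} (hT : ‖T‖ ≤ 1)
    {x : H} (hx : ‖x‖ = 1) :
    ‖adjoint T (T x) - x‖ ^ 2 ≤ 2 * (1 - ‖T x‖ ^ 2) := by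
  have h : ‖adjoint T (T x)‖ ≤ 1 := by
    refine ((adjoint T).le_of_opNorm_le (by simpa using hT) _).trans ?_
    simpa [hx] using T.le_of_opNorm_le hT x
  rw [norm_sub_sq (𝕜 := ℂ), adjoint_inner_left, inner_self_eq_norm_sq, hx]
  nlinarith [norm_nonneg (adjoint T (T x))]

theorem norm_inner_apply_apply_le [CompleteSpace H] {T : H →L[ℂ] H} (hT : ‖T‖ ≤ 1)
    {x z : H} (hx : ‖x‖ = 1) (hz : inner ℂ x z = 0) :
    ‖inner ℂ (T x) (T z)‖ ≤ √(2 * (1 - ‖T x‖ ^ 2)) * ‖z‖ := by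
  have h : inner ℂ (T x) (T z) = inner ℂ (adjoint T (T x) - x) z := by
    rw [inner_sub_left, adjoint_inner_left, hz, sub_zero]
  rw [h]
  refine (norm_inner_le_norm _ _).trans ?_
  gcongr
  exact Real.le_sqrt_of_sq_le (norm_adjoint_apply_apply_sub_sq_le hT hx)

/-- The operator sending `x` to `u` and acting on `xᗮ` as the compression of `T` to `uᗮ`. -/
noncomputable def replaceAt (T : H →L[ℂ] H) (x u : H) : H →L[ℂ] H :=
  (innerSL ℂ x).smulRight u + (.id ℂ H - (innerSL ℂ u).smulRight u) ∘L T ∘L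
    (.id ℂ H - (innerSL ℂ x).smulRight x)

theorem replaceAt_apply (T : H →L[ℂ] H) (x u z : H) :
    replaceAt T x u z = inner ℂ x z • u +
      (T (z - inner ℂ x z • x) - inner ℂ u (T (z - inner ℂ x z • x)) • u) := by
  simp only [replaceAt, add_apply, comp_apply, sub_apply, smulRight_apply, innerSL_apply_apply,
    id_apply]

theorem replaceAt_apply_self (T : H →L[ℂ] H) {x : H} (u : H) (hx : ‖x‖ = 1) :
    replaceAt T x u x = u := by
  simp [replaceAt_apply, inner_self_eq_norm_sq_to_K, hx]

theorem norm_replaceAt_le {T : H →L[ℂ] H} (hT : ‖T‖ ≤ 1) {x u : H} (hx : ‖x‖ = 1)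
    (hu : ‖u‖ = 1) : ‖replaceAt T x u‖ ≤ 1 := by
  refine opNorm_le_bound _ zero_le_one fun z ↦ ?_
  rw [one_mul]
  refine le_of_sq_le_sq ?_ (norm_nonneg z)
  rw [replaceAt_apply, norm_smul_add_sq_of_inner_eq_zero hu (inner_sub_inner_smul_self hu _),
    norm_sq_eq_norm_inner_sq_add hx z]
  set w := z - inner ℂ x z • x
  have h1 := norm_sq_eq_norm_inner_sq_add hu (T w)
  have h2 : ‖T w‖ ≤ ‖w‖ := by simpa using T.le_of_opNorm_le hT w
  nlinarith [sq_nonneg ‖inner ℂ u (T w)‖, norm_nonneg (T w)]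

theorem norm_replaceAt_sub_le {T : H →L[ℂ] H} {x u : H} {a b : ℝ} (hx : ‖x‖ = 1) (hu : ‖u‖ = 1)
    (ha : ‖u - T x‖ ≤ a) (hb : 0 ≤ b)
    (h : ∀ z, inner ℂ x z = 0 → ‖inner ℂ u (T z)‖ ≤ b * ‖z‖) :
    ‖replaceAt T x u - T‖ ≤ a + b := by
  have ha0 := (norm_nonneg _).trans ha
  refine opNorm_le_bound _ (by positivity) fun z ↦ ?_
  have key : (replaceAt T x u - T) z =
      inner ℂ x z • (u - T x) - inner ℂ u (T (z - inner ℂ x z • x)) • u := by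
    rw [sub_apply, replaceAt_apply, map_sub, map_smul, smul_sub]
    abel
  have hz := norm_sq_eq_norm_inner_sq_add hx z
  have hw : ‖z - inner ℂ x z • x‖ ≤ ‖z‖ :=
    le_of_sq_le_sq (by nlinarith [sq_nonneg ‖inner ℂ x z‖]) (norm_nonneg z)
  have hxz : ‖inner ℂ x z‖ ≤ ‖z‖ := by simpa [hx] using norm_inner_le_norm (𝕜 := ℂ) x z
  rw [key]
  refine (norm_sub_le _ _).trans ?_
  rw [norm_smul, norm_smul, hu, mul_one, add_mul, mul_comm a]
  gcongr
  exact (h _ (inner_sub_inner_smul_self hx z)).trans (by gcongr)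

end

theorem stmt4 {H : Type*} [NormedAddCommGroup H] [InnerProductSpace ℂ H] [CompleteSpace H] :
    ∀ ε > (0 : ℝ), ∃ η > (0 : ℝ), ∀ T : H →L[ℂ] H, ‖T‖ = 1 →
      ∀ x₀ : H, ‖x₀‖ = 1 → ‖T x₀‖ > 1 - η →
      ∃ S : H →L[ℂ] H, ‖S‖ = 1 ∧ ‖S x₀‖ = 1 ∧ ‖S - T‖ < ε := by
  intro ε hε
  -- `δ` is the square root of `η`
  obtain ⟨δ, hδ, hδ2, hδε⟩ : ∃ δ > (0 : ℝ), δ ≤ 1 / 2 ∧ 5 * δ < ε :=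
    ⟨min (1 / 2) (ε / 6), by positivity, min_le_left _ _, by
      linarith [min_le_right (1 / 2) (ε / 6)]⟩
  refine ⟨δ ^ 2, by positivity, fun T hT x hx hTx ↦ ?_⟩
  have ht1 : ‖T x‖ ≤ 1 := by simpa [hx] using T.le_of_opNorm_le hT.le x
  have ht2 : 1 / 2 ≤ ‖T x‖ := by nlinarith
  have ht0 : 0 < ‖T x‖ := by linarith
  set u : H := ((‖T x‖⁻¹ : ℝ) : ℂ) • T x with hu_def
  have hu : ‖u‖ = 1 := by
    rw [hu_def, norm_smul, Complex.norm_real, norm_inv, norm_norm, inv_mul_cancel₀ ht0.ne']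
  have hux : ‖u - T x‖ ≤ δ := by
    have : u - T x = ((‖T x‖⁻¹ - 1 : ℝ) : ℂ) • T x := by
      rw [hu_def, Complex.ofReal_sub, sub_smul, Complex.ofReal_one, one_smul]
    rw [this, norm_smul, Complex.norm_real, Real.norm_of_nonneg
      (sub_nonneg.2 ((one_le_inv₀ ht0).2 ht1)), sub_mul, inv_mul_cancel₀ ht0.ne']
    nlinarith
  have hinner (z : H) (hz : inner ℂ x z = 0) : ‖inner ℂ u (T z)‖ ≤ 4 * δ * ‖z‖ := by
    have h1 : √(2 * (1 - ‖T x‖ ^ 2)) ≤ 2 * δ := Real.sqrt_le_iff.2 ⟨by positivity, by nlinarith⟩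
    have h2 : ‖T x‖⁻¹ ≤ 2 := inv_le_of_inv_le₀ two_pos (by linarith)
    rw [hu_def, inner_smul_left, norm_mul, RCLike.norm_conj, Complex.norm_real, norm_inv, norm_norm]
    calc ‖T x‖⁻¹ * ‖inner ℂ (T x) (T z)‖ ≤ 2 * (2 * δ * ‖z‖) := by
          gcongr
          exact (norm_inner_apply_apply_le hT.le hx hz).trans (by gcongr)
      _ = 4 * δ * ‖z‖ := by ring
  have hSx : ‖replaceAt T x u x‖ = 1 := by rw [replaceAt_apply_self T u hx, hu]
  refine ⟨replaceAt T x u, (norm_replaceAt_le hT.le hx hu).antisymm ?_, hSx, ?_⟩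
  · simpa [hSx, hx] using (replaceAt T x u).le_opNorm x
  · linarith [norm_replaceAt_sub_le hx hu hux (by positivity) hinner]
end

section
/- Every complex Hilbert space H has the Bishop-Phelps-Bollobás point property for self-adjoint operators: for every ε > 0 there exists η > 0 such that whenever T is a bounded linear operator on H with T* = T, ‖T‖ = 1, and x₀ ∈ H is a unit vector satisfying ‖T x₀‖ > 1 − η, there exists a bounded linear operator S on H with S* = S, ‖S‖ = 1, ‖S x₀‖ = 1, and ‖S − T‖ < ε. -/
open ContinuousLinearMap

/-- A self-adjoint contraction `T` that is close to a self-adjoint partial isometry `R` on the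
range of `R` is close to a self-adjoint contraction which agrees with `R` there. -/
theorem exists_isSelfAdjoint_contraction_eq_partialIsometry
    {H : Type*} [NormedAddCommGroup H] [InnerProductSpace ℂ H] [CompleteSpace H]
    {R T : H →L[ℂ] H} (hR : IsSelfAdjoint R) (hT : IsSelfAdjoint T) (hR3 : R * R * R = R)
    (hT1 : ‖T‖ ≤ 1) {κ : ℝ} (hκ : ‖T * R - R * R‖ ≤ κ) :
    ∃ S : H →L[ℂ] H, IsSelfAdjoint S ∧ ‖S‖ ≤ 1 ∧ S * R = R * R ∧ ‖S - T‖ ≤ 2 * κ := by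
  have hP : IsStarProjection (R * R) := ⟨by
    rw [IsIdempotentElem, ← mul_assoc, hR3], by
    rw [IsSelfAdjoint, star_mul, hR.star_eq]⟩
  have hQ : IsStarProjection (1 - R * R) := hP.one_sub
  have hPn : ‖R * R‖ ≤ 1 := hP.norm_le
  have hQn : ‖1 - R * R‖ ≤ 1 := hQ.norm_le
  have hRn : ‖R‖ ≤ 1 := by
    have h := CStarRing.norm_star_mul_self (x := R)
    rw [hR.star_eq] at h
    nlinarith [norm_nonneg R]
  have hRQ : R * (1 - R * R) = 0 := by rw [mul_sub, mul_one, ← mul_assoc, hR3, sub_self]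
  have hQR : (1 - R * R) * R = 0 := by rw [sub_mul, one_mul, hR3, sub_self]
  have hsym (A : H →L[ℂ] H) (hA : IsSelfAdjoint A) (x y : H) :
      inner ℂ (A x) y = inner ℂ x (A y) := hA.isSymmetric x y
  set Q := 1 - R * R with hQdef
  refine ⟨R + Q * T * Q, ?_, ?_, ?_, ?_⟩
  · rw [IsSelfAdjoint, star_add, star_mul, star_mul, hR.star_eq, hT.star_eq,
      hQ.isSelfAdjoint.star_eq, mul_assoc]
  · refine opNorm_le_bound _ zero_le_one fun x => ?_
    have h₁ : inner ℂ (R x) ((Q * T * Q) x) = 0 := by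
      have h : R ((Q * T * Q) x) = (R * Q) (T (Q x)) := rfl
      rw [hsym R hR, h, hRQ, zero_apply, inner_zero_right]
    have h₂ : inner ℂ (R (R x)) (Q x) = 0 := by
      have h : R (Q x) = (R * Q) x := rfl
      rw [hsym R hR, h, hRQ, zero_apply, inner_zero_right]
    have h₃ : x = R (R x) + Q x := by simp [hQdef]
    have h₄ : ‖R x‖ ≤ ‖R (R x)‖ := by
      have h : R x = R (R (R x)) := by
        conv_lhs => rw [← hR3]
        rfl
      conv_lhs => rw [h]
      exact (R.le_of_opNorm_le hRn _).trans (one_mul _).le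
    have h₅ : ‖(Q * T * Q) x‖ ≤ ‖Q x‖ := by
      have h : ‖Q * T‖ ≤ 1 := (norm_mul_le _ _).trans (mul_le_one₀ hQn (norm_nonneg _) hT1)
      exact ((Q * T).le_of_opNorm_le h (Q x)).trans (one_mul _).le
    have h₆ := norm_add_sq_eq_norm_sq_add_norm_sq_of_inner_eq_zero _ _ h₁
    have h₇ := norm_add_sq_eq_norm_sq_add_norm_sq_of_inner_eq_zero _ _ h₂
    rw [← h₃] at h₇
    rw [one_mul, add_apply]
    refine abs_le_of_sq_le_sq' ?_ (norm_nonneg _) |>.2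
    nlinarith [norm_nonneg (R x), norm_nonneg ((Q * T * Q) x)]
  · rw [add_mul, mul_assoc, hQR, mul_zero, add_zero]
  · have h : R + Q * T * Q - T = -(R * star (T * R - R * R)) - Q * ((T * R - R * R) * R) := by
      have h₁ : R * star (T * R - R * R) = R * R * T - R := by
        rw [star_sub, star_mul, hP.isSelfAdjoint.star_eq, hR.star_eq, hT.star_eq, mul_sub,
          ← mul_assoc, ← mul_assoc, hR3]
      have h₂ : Q * ((T * R - R * R) * R) = Q * T * (R * R) := by
        rw [sub_mul (T * R), hR3, mul_sub Q, hQR, sub_zero, mul_assoc, mul_assoc]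
      rw [h₁, h₂, hQdef]
      noncomm_ring
    have hD : ‖star (T * R - R * R)‖ ≤ κ := by rwa [norm_star]
    have hκ0 : 0 ≤ κ := (norm_nonneg _).trans hκ
    rw [h]
    calc _ ≤ ‖R * star (T * R - R * R)‖ + ‖Q * ((T * R - R * R) * R)‖ := by
          simpa using norm_sub_le (-(R * star (T * R - R * R))) (Q * ((T * R - R * R) * R))
      _ ≤ 1 * κ + 1 * (κ * 1) := by
          gcongr
          · exact norm_mul_le_of_le hRn hD
          · exact norm_mul_le_of_le hQn (norm_mul_le_of_le hκ hRn)
      _ = 2 * κ := by ring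

open InnerProductSpace in
/-- If a unit vector is the orthogonal sum of an approximate fixed vector `a` and an approximate
anti-fixed vector `b` of a self-adjoint contraction `T`, then some nearby self-adjoint operator
of norm one attains its norm there. -/
theorem exists_isSelfAdjoint_norm_attaining_of_approx_eigenvectors
    {H : Type*} [NormedAddCommGroup H] [InnerProductSpace ℂ H] [CompleteSpace H]
    {T : H →L[ℂ] H} (hT : IsSelfAdjoint T) (hT1 : ‖T‖ ≤ 1) {a b : H}
    (hab : inner ℂ a b = 0) (hn : ‖a + b‖ = 1) {κ : ℝ} (hκ : 0 ≤ κ)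
    (ha : ‖T a - a‖ ≤ κ * ‖a‖) (hb : ‖T b + b‖ ≤ κ * ‖b‖) :
    ∃ S : H →L[ℂ] H, IsSelfAdjoint S ∧ ‖S‖ = 1 ∧ ‖S (a + b)‖ = 1 ∧ ‖S - T‖ ≤ 4 * κ := by
  have normalize (x : H) : ∃ e : H, ‖e‖ ≤ 1 ∧ x = (‖x‖ : ℂ) • e ∧ e = ((‖x‖⁻¹ : ℝ) : ℂ) • x ∧
      inner ℂ e e • e = e := by
    refine ⟨((‖x‖⁻¹ : ℝ) : ℂ) • x, ?_⟩
    rcases eq_or_ne x 0 with rfl | hx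
    · simp
    · have hx' : ‖x‖ ≠ 0 := norm_ne_zero_iff.2 hx
      have he : ‖((‖x‖⁻¹ : ℝ) : ℂ) • x‖ = 1 := by
        rw [norm_smul, Complex.norm_real, norm_inv, norm_norm, inv_mul_cancel₀ hx']
      refine ⟨he.le, ?_, rfl, ?_⟩
      · rw [smul_smul, ← Complex.ofReal_mul, mul_inv_cancel₀ hx', Complex.ofReal_one, one_smul]
      · rw [inner_self_eq_norm_sq_to_K, he]
        simp
  obtain ⟨e, he1, hae, hea, hee⟩ := normalize a
  obtain ⟨f, hf1, hbf, hfb, hff⟩ := normalize b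
  have hef : inner ℂ e f = 0 := by rw [hea, hfb, inner_smul_left, inner_smul_right, hab]; simp
  have hfe : inner ℂ f e = 0 := inner_eq_zero_symm.1 hef
  have hTe : ‖T e - e‖ ≤ κ := by
    rw [hea, map_smul, ← smul_sub, norm_smul, Complex.norm_real, norm_inv, norm_norm]
    exact inv_mul_le_of_le_mul₀ (norm_nonneg _) hκ (by rwa [mul_comm] at ha)
  have hTf : ‖T f + f‖ ≤ κ := by
    rw [hfb, map_smul, ← smul_add, norm_smul, Complex.norm_real, norm_inv, norm_norm]
    exact inv_mul_le_of_le_mul₀ (norm_nonneg _) hκ (by rwa [mul_comm] at hb)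
  set R : H →L[ℂ] H := rankOne ℂ e e - rankOne ℂ f f with hRdef
  have hR : IsSelfAdjoint R := by
    rw [IsSelfAdjoint, star_eq_adjoint, hRdef, map_sub, adjoint_rankOne, adjoint_rankOne]
  have hRx (x : H) : R x = inner ℂ e x • e - inner ℂ f x • f := by simp [hRdef]
  have hRe : R e = e := by rw [hRx, hee, hfe, zero_smul, sub_zero]
  have hRf : R f = -f := by rw [hRx, hff, hef, zero_smul, zero_sub]
  have hRR (x : H) : R (R x) = inner ℂ e x • e + inner ℂ f x • f := by
    rw [hRx x, map_sub, map_smul, map_smul, hRe, hRf, smul_neg, sub_neg_eq_add]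
  have hR3 : R * R * R = R := by
    ext x
    change R (R (R x)) = R x
    rw [hRR x, map_add, map_smul, map_smul, hRe, hRf, hRx x, smul_neg, sub_eq_add_neg]
  have hD : ‖T * R - R * R‖ ≤ 2 * κ := by
    have h : T * R - R * R = rankOne ℂ (T e - e) e - rankOne ℂ (T f + f) f := by
      ext x
      change T (R x) - R (R x) = _
      rw [hRR, hRx, map_sub, map_smul, map_smul, sub_apply, rankOne_apply, rankOne_apply,
        smul_sub, smul_add]
      abel
    rw [h]
    refine (norm_sub_le _ _).trans ?_
    rw [norm_rankOne, norm_rankOne]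
    nlinarith [mul_le_mul hTe he1 (norm_nonneg _) hκ, mul_le_mul hTf hf1 (norm_nonneg _) hκ]
  obtain ⟨S, hS, hS1, hSR, hST⟩ :=
    exists_isSelfAdjoint_contraction_eq_partialIsometry hR hT hR3 hT1 hD
  have hRa : R a = a := by rw [hae, map_smul, hRe, ← hae]
  have hRb : R b = -b := by rw [hbf, map_smul, hRf, smul_neg, ← hbf]
  have hRab : R (a - b) = a + b := by rw [map_sub, hRa, hRb, sub_neg_eq_add]
  have hRab' : R (a + b) = a - b := by rw [map_add, hRa, hRb, sub_eq_add_neg]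
  have hSab : S (a + b) = a - b := by
    have h := DFunLike.congr_fun hSR (a - b)
    change S (R (a - b)) = R (R (a - b)) at h
    rwa [hRab, hRab'] at h
  have hSn : ‖S (a + b)‖ = 1 := by
    rw [hSab, ← hn]
    exact (norm_sub_rev _ _).trans ((norm_sub_eq_norm_add hab).trans (by rw [add_comm]))
  refine ⟨S, hS, le_antisymm hS1 ?_, hSn, by linarith⟩
  have h := S.le_opNorm (a + b)
  rwa [hSn, hn, mul_one] at h

theorem stmt5 {H : Type*} [NormedAddCommGroup H] [InnerProductSpace ℂ H] [CompleteSpace H] :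
    ∀ ε > (0 : ℝ), ∃ η > (0 : ℝ), ∀ T : H →L[ℂ] H, (adjoint T = T) → ‖T‖ = 1 →
      ∀ x₀ : H, ‖x₀‖ = 1 → ‖T x₀‖ > 1 - η →
      ∃ S : H →L[ℂ] H, (adjoint S = S) ∧ ‖S‖ = 1 ∧ ‖S x₀‖ = 1 ∧ ‖S - T‖ < ε := by
  intro ε hε
  obtain ⟨δ, hδ, hδ1, hδε⟩ : ∃ δ > (0 : ℝ), δ ≤ 1 ∧ 8 * δ < ε :=
    ⟨min 1 (ε / 9), by positivity, min_le_left _ _, by linarith [min_le_right 1 (ε / 9)]⟩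
  refine ⟨δ ^ 4 / 8, by positivity, fun T hT hT1 x hx hTx => ?_⟩
  suffices h : ∃ a b : H, inner ℂ a b = 0 ∧ a + b = x ∧ ‖T a - a‖ ≤ 2 * δ * ‖a‖ ∧
      ‖T b + b‖ ≤ 2 * δ * ‖b‖ by
    obtain ⟨a, b, hab, rfl, ha, hb⟩ := h
    obtain ⟨S, hS, hS1, hSx, hST⟩ := exists_isSelfAdjoint_norm_attaining_of_approx_eigenvectors
      (T := T) hT hT1.le hab hx (by positivity) ha hb
    exact ⟨S, hS, hS1, hSx, by linarith⟩
  have hsym (y z : H) : inner ℂ (T y) z = inner ℂ y (T z) :=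
    (show IsSelfAdjoint T from hT).isSymmetric y z
  have hcontr (y : H) : ‖T y‖ ≤ ‖y‖ := (T.le_of_opNorm_le hT1.le y).trans (one_mul _).le
  have hTx1 : ‖T x‖ ≤ 1 := (hcontr x).trans hx.le
  have hδ4 : δ ^ 4 ≤ 1 := pow_le_one₀ hδ.le hδ1
  have hTxsq : 1 - ‖T x‖ ^ 2 ≤ δ ^ 4 / 4 := by nlinarith
  have hTT : ‖T (T x) - x‖ ≤ δ ^ 2 / 2 := by
    have h := norm_sub_sq (𝕜 := ℂ) (T (T x)) x
    rw [hsym, inner_self_eq_norm_sq, hx] at h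
    have h' := hcontr (T x)
    refine abs_le_of_sq_le_sq' ?_ (by positivity) |>.2
    nlinarith [norm_nonneg (T (T x))]
  obtain ⟨u, hu⟩ : ∃ u : H, u = (2⁻¹ : ℂ) • (x + T x) := ⟨_, rfl⟩
  obtain ⟨v, hv⟩ : ∃ v : H, v = (2⁻¹ : ℂ) • (x - T x) := ⟨_, rfl⟩
  have h2 : ‖(2⁻¹ : ℂ)‖ = 2⁻¹ := by simp
  have huv : u + v = x := by rw [hu, hv]; module
  have hTu : ‖T u - u‖ ≤ δ ^ 2 / 4 := by
    have h : T u - u = (2⁻¹ : ℂ) • (T (T x) - x) := by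
      rw [hu, map_smul, map_add]; module
    rw [h, norm_smul, h2]
    linarith
  have hTv : ‖T v + v‖ ≤ δ ^ 2 / 4 := by
    have h : T v + v = (-2⁻¹ : ℂ) • (T (T x) - x) := by
      rw [hv, map_smul, map_sub]; module
    rw [h, norm_smul, norm_neg, h2]
    linarith
  have hu1 : ‖u‖ ≤ 1 := by
    rw [hu, norm_smul, h2]
    linarith [norm_add_le x (T x)]
  rcases le_or_gt ‖v‖ δ with hvδ | hvδ
  · refine ⟨x, 0, by simp, by simp, ?_, by simp⟩
    have h : T x - x = (-2 : ℂ) • v := by rw [hv]; module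
    rw [h, norm_smul, hx]
    simpa using hvδ
  rcases le_or_gt ‖u‖ δ with huδ | huδ
  · refine ⟨0, x, by simp, by simp, by simp, ?_⟩
    have h : T x + x = (2 : ℂ) • u := by rw [hu]; module
    rw [h, norm_smul, hx]
    simpa using huδ
  have hinner : ‖inner ℂ u v‖ ≤ δ ^ 4 / 16 := by
    have h : inner ℂ u v = (((1 - ‖T x‖ ^ 2) / 4 : ℝ) : ℂ) := by
      rw [hu, hv, inner_smul_left, inner_smul_right, inner_add_left, inner_sub_right,
        inner_sub_right, hsym x x, inner_self_eq_norm_sq_to_K, inner_self_eq_norm_sq_to_K, hx,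
        map_inv₀, map_ofNat]
      simp
      ring
    rw [h, Complex.norm_real, Real.norm_of_nonneg (by nlinarith [norm_nonneg (T x)])]
    linarith
  have hu0 : 0 < ‖u‖ := hδ.trans huδ
  obtain ⟨c, hc⟩ : ∃ c : ℂ, c = inner ℂ u v / (‖u‖ : ℂ) ^ 2 := ⟨_, rfl⟩
  have hcn : ‖c‖ ≤ δ ^ 2 / 16 := by
    rw [hc, norm_div, norm_pow, Complex.norm_real, norm_norm, div_le_iff₀ (by positivity)]
    nlinarith [mul_le_mul_of_nonneg_left (pow_le_pow_left₀ hδ.le huδ.le 2) (sq_nonneg δ)]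
  have hcu : ‖c • u‖ ≤ δ ^ 2 / 16 := by
    rw [norm_smul]
    nlinarith [norm_nonneg c]
  refine ⟨(1 + c) • u, v - c • u, ?_, ?_, ?_, ?_⟩
  · rw [inner_smul_left, inner_sub_right, inner_smul_right, inner_self_eq_norm_sq_to_K, hc]
    have : (‖u‖ : ℂ) ≠ 0 := by exact_mod_cast hu0.ne'
    simp [this]
  · rw [← huv]; module
  · rw [map_smul, ← smul_sub, norm_smul, norm_smul, mul_left_comm]
    gcongr
    nlinarith
  · have h₁ : T (v - c • u) + (v - c • u) = (T v + v) - (T (c • u) + c • u) := by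
      rw [map_sub]; abel
    have h₂ := norm_sub_le (T v + v) (T (c • u) + c • u)
    have h₃ := norm_add_le (T (c • u)) (c • u)
    have h₄ := hcontr (c • u)
    have h₅ := norm_sub_norm_le v (c • u)
    rw [h₁]
    nlinarith
end

section
/- Every complex Hilbert space H has the Bishop-Phelps-Bollobás point property for compact self-adjoint operators: for every ε > 0 there exists η > 0 such that whenever T is a compact bounded linear operator on H with T* = T, ‖T‖ = 1, and x₀ ∈ H is a unit vector satisfying ‖T x₀‖ > 1 − η, there exists a compact bounded linear operator S on H with S* = S, ‖S‖ = 1, ‖S x₀‖ = 1, and ‖S − T‖ < ε. -/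
open ContinuousLinearMap

section Clamp

variable {A : Type*} [CStarAlgebra A]

/-- Clamping `t / r` to `[-1, 1]` through the continuous functional calculus. -/
lemma IsSelfAdjoint.exists_clamp {T : A} (hT : IsSelfAdjoint T) (hn : ‖T‖ ≤ 1) {r : ℝ}
    (hr : 0 < r) (hr1 : r ≤ 1) :
    ∃ F : A, IsSelfAdjoint F ∧ ‖F‖ ≤ 1 ∧ ‖F - T‖ ≤ 1 - r ∧ Commute T F ∧
      (T - r • F) * (1 - F * F) = 0 ∧ ∃ B, F = T * B := by
  have hpos (t : ℝ) : 0 < max r |t| := lt_of_lt_of_le hr (le_max_left _ _)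
  have hh : Continuous fun t : ℝ => (max r |t|)⁻¹ :=
    (continuous_const.max continuous_abs).inv₀ fun t => (hpos t).ne'
  have hf : Continuous fun t : ℝ => t * (max r |t|)⁻¹ := continuous_id.mul hh
  obtain ⟨f, hft⟩ : ∃ f : ℝ → ℝ, ∀ t, f t = t * (max r |t|)⁻¹ := ⟨_, fun _ => rfl⟩
  replace hf : Continuous f := by rwa [funext hft]
  have hfT : cfc f T = T * cfc (fun t : ℝ => (max r |t|)⁻¹) T := by
    rw [funext hft, cfc_mul (fun t : ℝ => t) _ T continuousOn_id hh.continuousOn, cfc_id' ℝ T]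
  have hspec (t : ℝ) (ht : t ∈ spectrum ℝ T) : |t| ≤ 1 := by
    obtain _ | _ := subsingleton_or_nontrivial A
    · simp [spectrum.of_subsingleton] at ht
    · exact (spectrum.norm_le_norm_of_mem ht).trans hn
  refine ⟨cfc f T, cfc_predicate f T, ?_, ?_, ?_, ?_, _, hfT⟩
  · refine norm_cfc_le zero_le_one fun t _ => ?_
    rw [hft, Real.norm_eq_abs, abs_mul, abs_inv, abs_of_pos (hpos t), ← div_eq_mul_inv,
      div_le_one (hpos t)]
    exact le_max_right _ _
  · have e : cfc f T - T = cfc (fun t => f t - t) T := by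
      rw [cfc_sub f (fun t => t) T, cfc_id' ℝ T]
    rw [e]
    refine norm_cfc_le (by linarith) fun t ht => ?_
    have hm : max r |t| ≤ 1 := max_le hr1 (hspec t ht)
    have hm' : r ≤ max r |t| := le_max_left _ _
    have h2 : f t - t = t * (max r |t|)⁻¹ * (1 - max r |t|) := by
      rw [hft]
      field_simp [(hpos t).ne']
    rw [h2, Real.norm_eq_abs, abs_mul, abs_mul, abs_inv, abs_of_pos (hpos t), ← div_eq_mul_inv,
      abs_of_nonneg (sub_nonneg.2 hm)]
    have h3 : |t| / max r |t| ≤ 1 := (div_le_one (hpos t)).2 (le_max_right _ _)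
    nlinarith [sub_nonneg.2 hm]
  · have := cfc_commute_cfc (fun t : ℝ => t) f T
    rwa [cfc_id' ℝ T] at this
  · have e1 : T - r • cfc f T = cfc (fun t => t - r * f t) T := by
      rw [cfc_sub (fun t => t) (fun t => r * f t) T, cfc_const_mul r f T, cfc_id' ℝ T]
    have e2 : 1 - cfc f T * cfc f T = cfc (fun t => 1 - f t * f t) T := by
      rw [cfc_sub (fun _ => 1) (fun t => f t * f t) T, cfc_mul f f T, cfc_const_one ℝ T]
    rw [e1, e2, ← cfc_mul (fun t => t - r * f t) (fun t => 1 - f t * f t) T, ← cfc_const_zero ℝ T]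
    refine cfc_congr fun t _ => ?_
    rcases le_total |t| r with h | h
    · simp only [hft, max_eq_left h]
      field_simp
      simp
    · have h0 : |t| ≠ 0 := (hr.trans_le h).ne'
      have : f t * f t = 1 := by
        rw [hft, max_eq_right h]
        field_simp
        exact (sq_abs t).symm
      simp only [this]
      simp

end Clamp

section Hilbert

variable {H : Type*} [NormedAddCommGroup H] [InnerProductSpace ℂ H]

/-- The reflection through the line spanned by a unit vector. -/
noncomputable def lineReflection (u : H) : H →L[ℂ] H :=
  (2 : ℝ) • InnerProductSpace.rankOne ℂ u u - 1

lemma lineReflection_apply (u x : H) :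
    lineReflection u x = (2 : ℝ) • (inner ℂ u x • u) - x := rfl

lemma lineReflection_mul_self {u : H} (hu : ‖u‖ = 1) :
    lineReflection u * lineReflection u = 1 := by
  ext x
  change lineReflection u (lineReflection u x) = x
  have h : inner ℂ u (lineReflection u x) = inner ℂ u x := by
    rw [lineReflection_apply, ← Complex.coe_smul, inner_sub_right, inner_smul_right,
      inner_smul_right, inner_self_eq_norm_sq_to_K, hu]
    simp
    ring
  rw [lineReflection_apply, h, lineReflection_apply]
  abel

variable [CompleteSpace H]

/-- A vector on which a self-adjoint contraction nearly attains its norm decomposes into a vector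
on which the clamped operator is isometric and a small remainder. -/
lemma exists_norm_clamp_apply_eq {T F : H →L[ℂ] H} (hT : IsSelfAdjoint T) (hTn : ‖T‖ ≤ 1)
    (hF : IsSelfAdjoint F) (hFn : ‖F‖ ≤ 1) (hTF : Commute T F) {r : ℝ} (hr : 0 ≤ r)
    (h0 : (T - r • F) * (1 - F * F) = 0) (x : H) :
    ∃ y : H, inner ℂ y (x - y) = 0 ∧ ‖F y‖ = ‖y‖ ∧
      ‖T x‖ ^ 2 ≤ ‖x‖ ^ 2 - (1 - r ^ 2) * ‖x - y‖ ^ 2 := by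
  set G : H →L[ℂ] H := 1 - F * F with hG
  have hGs : adjoint G = G := by
    rw [← isSelfAdjoint_iff']
    have h : IsSelfAdjoint (F * F) := by simpa [sq] using hF.pow 2
    exact (IsSelfAdjoint.one _).sub h
  have hTG : Commute T G := (Commute.one_right T).sub_right (hTF.mul_right hTF)
  have : CompleteSpace G.ker := G.isClosed_ker.completeSpace_coe
  have hyE : G.ker.starProjection x ∈ G.ker := Submodule.starProjection_apply_mem _ _
  have hzE : x - G.ker.starProjection x ∈ G.kerᗮ := Submodule.sub_starProjection_mem_orthogonal x
  set y := G.ker.starProjection x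
  set z := x - y with hz
  have hGy : G y = 0 := hyE
  have hyz : inner ℂ y z = 0 := hzE y hyE
  have hFFy : F (F y) = y := by
    have : y - F (F y) = 0 := hGy
    exact (sub_eq_zero.1 this).symm
  have hTz : T z = r • F z := by
    have hle : G.range.topologicalClosure ≤ (T - r • F).ker := by
      refine Submodule.topologicalClosure_minimal _ ?_ (T - r • F).isClosed_ker
      rintro _ ⟨w, rfl⟩
      exact DFunLike.congr_fun h0 w
    rw [orthogonal_ker, hGs] at hzE
    have : T z - r • F z = 0 := hle hzE
    exact sub_eq_zero.1 this
  have hTyz : inner ℂ (T y) (T z) = 0 := by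
    have h1 : T (T y) ∈ G.ker := by
      change (G * (T * T)) y = 0
      rw [← (hTG.mul_left hTG).eq]
      change T (T (G y)) = 0
      simp [hGy]
    have h2 : inner ℂ (T (T y)) z = 0 := hzE _ h1
    rwa [← hT.adjoint_eq, adjoint_inner_left, hT.adjoint_eq] at h2
  refine ⟨y, hyz, ?_, ?_⟩
  · refine le_antisymm ?_ ?_
    · simpa using F.le_of_opNorm_le hFn y
    · simpa [hFFy] using F.le_of_opNorm_le hFn (F y)
  · have hx : x = y + z := by simp [hz]
    have e1 : ‖T x‖ ^ 2 = ‖T y‖ ^ 2 + ‖T z‖ ^ 2 := by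
      rw [hx, map_add]
      simpa [sq] using norm_add_sq_eq_norm_sq_add_norm_sq_of_inner_eq_zero _ _ hTyz
    have e2 : ‖x‖ ^ 2 = ‖y‖ ^ 2 + ‖z‖ ^ 2 := by
      rw [hx]
      simpa [sq] using norm_add_sq_eq_norm_sq_add_norm_sq_of_inner_eq_zero _ _ hyz
    have b1 : ‖T y‖ ≤ ‖y‖ := by simpa using T.le_of_opNorm_le hTn y
    have b2 : ‖T z‖ ≤ r * ‖z‖ := by
      rw [hTz, norm_smul, Real.norm_eq_abs, abs_of_nonneg hr]
      gcongr
      simpa using F.le_of_opNorm_le hFn z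
    have c1 : ‖T y‖ ^ 2 ≤ ‖y‖ ^ 2 := by gcongr
    have c2 : ‖T z‖ ^ 2 ≤ (r * ‖z‖) ^ 2 := by gcongr
    rw [e1, e2]
    nlinarith

lemma isSelfAdjoint_lineReflection (u : H) : IsSelfAdjoint (lineReflection u) := by
  have h : IsSelfAdjoint (InnerProductSpace.rankOne ℂ u u) := by
    rw [isSelfAdjoint_iff']; simp
  exact ((IsSelfAdjoint.all (2 : ℝ)).smul h).sub (IsSelfAdjoint.one _)

lemma lineReflection_mem_unitary {u : H} (hu : ‖u‖ = 1) :
    lineReflection u ∈ unitary (H →L[ℂ] H) := by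
  rw [Unitary.mem_iff, (isSelfAdjoint_lineReflection u).star_eq]
  exact ⟨lineReflection_mul_self hu, lineReflection_mul_self hu⟩

lemma norm_lineReflection_sub_le {u v : H} (hu : ‖u‖ = 1) (hv : ‖v‖ = 1) :
    ‖lineReflection u - lineReflection v‖ ≤ 4 * ‖u - v‖ := by
  have h : lineReflection u - lineReflection v =
      (2 : ℝ) • (InnerProductSpace.rankOne ℂ u (u - v) + InnerProductSpace.rankOne ℂ (u - v) v) := by
    simp only [lineReflection, map_sub, sub_apply]
    module
  rw [h, norm_smul, Real.norm_eq_abs, abs_two]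
  have := norm_add_le (InnerProductSpace.rankOne ℂ u (u - v))
    (InnerProductSpace.rankOne ℂ (u - v) v)
  rw [InnerProductSpace.norm_rankOne, InnerProductSpace.norm_rankOne, hu, hv] at this
  linarith

/-- Two unit vectors with nonnegative inner product are related by a unitary near the identity. -/
lemma exists_unitary_apply_eq {x e : H} (hx : ‖x‖ = 1) (he : ‖e‖ = 1) {c : ℝ} (hc : 0 ≤ c)
    (hxe : inner ℂ x e = (c : ℂ)) :
    ∃ U ∈ unitary (H →L[ℂ] H), U e = x ∧ ‖U - 1‖ ≤ 4 * ‖x - e‖ := by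
  have hsq : ‖x + e‖ ^ 2 = 2 * (1 + c) := by
    rw [@norm_add_sq ℂ, hx, he, hxe]
    simp
    ring
  have hs : 0 < ‖x + e‖ := by
    by_contra h
    have : ‖x + e‖ = 0 := le_antisymm (not_lt.1 h) (norm_nonneg _)
    rw [this] at hsq
    linarith
  set u : H := (‖x + e‖⁻¹ : ℝ) • (x + e) with hu
  have hu1 : ‖u‖ = 1 := by
    rw [hu, norm_smul, norm_inv, norm_norm, inv_mul_cancel₀ hs.ne']
  have hRe : lineReflection e e = e := by
    rw [lineReflection_apply, inner_self_eq_norm_sq_to_K, he]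
    simp only [Complex.coe_algebraMap, Complex.ofReal_one, one_pow, one_smul]
    module
  have hRu : lineReflection u e = x := by
    have h1 : inner ℂ u e = ((‖x + e‖⁻¹ * (1 + c) : ℝ) : ℂ) := by
      rw [hu, ← Complex.coe_smul, inner_smul_left, inner_add_left, hxe,
        inner_self_eq_norm_sq_to_K, he]
      simp [add_comm]
    have h2 : 2 * (‖x + e‖⁻¹ * (1 + c)) * ‖x + e‖⁻¹ = 1 := by
      field_simp
      linarith
    rw [lineReflection_apply, h1, Complex.coe_smul, hu, smul_smul, smul_smul, h2, one_smul,
      add_sub_cancel_right]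
  have hue : ‖u - e‖ ≤ ‖x - e‖ := by
    have h1 : u - e = (u - (2⁻¹ : ℝ) • (x + e)) + (2⁻¹ : ℝ) • (x - e) := by module
    have h2 : u - (2⁻¹ : ℝ) • (x + e) = (1 - ‖x + e‖ / 2) • u := by
      rw [hu, smul_smul, ← sub_smul]
      congr 1
      field_simp
    have h3 : |1 - ‖x + e‖ / 2| ≤ ‖x - e‖ / 2 := by
      have a1 : ‖x + e‖ ≤ 2 := (norm_add_le _ _).trans (by rw [hx, he]; norm_num)
      have a2 : ‖(2 : ℝ) • e‖ ≤ ‖x + e‖ + ‖x - e‖ := by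
        have : (2 : ℝ) • e = (x + e) - (x - e) := by module
        rw [this]
        exact norm_sub_le _ _
      rw [norm_smul, he, Real.norm_eq_abs, abs_two] at a2
      rw [abs_of_nonneg (by linarith)]
      linarith
    calc ‖u - e‖ ≤ ‖u - (2⁻¹ : ℝ) • (x + e)‖ + ‖(2⁻¹ : ℝ) • (x - e)‖ := by
          rw [h1]; exact norm_add_le _ _
      _ ≤ ‖x - e‖ := by
          rw [h2, norm_smul _ u, hu1, norm_smul, Real.norm_eq_abs, Real.norm_eq_abs,
            abs_of_pos (by norm_num : (0 : ℝ) < 2⁻¹)]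
          linarith
  refine ⟨lineReflection u * lineReflection e,
    mul_mem (lineReflection_mem_unitary hu1) (lineReflection_mem_unitary he), ?_, ?_⟩
  · change lineReflection u (lineReflection e e) = x
    rw [hRe, hRu]
  · have h : lineReflection u * lineReflection e - 1 =
        (lineReflection u - lineReflection e) * lineReflection e := by
      noncomm_ring [lineReflection_mul_self he]
    have h' := CStarRing.norm_mul_mem_unitary (E := H →L[ℂ] H) (lineReflection u - lineReflection e)
      (lineReflection_mem_unitary he)
    rw [h, h']
    exact (norm_lineReflection_sub_le hu1 he).trans (by linarith)

end Hilbert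

lemma norm_unitary_conj_sub_le {A : Type*} [CStarAlgebra A] {U : A} (hU : U ∈ unitary A) (F : A) :
    ‖U * F * star U - F‖ ≤ 2 * ‖F‖ * ‖U - 1‖ := by
  have h : U * F * star U - F = ((U - 1) * F - F * (U - 1)) * star U := by
    have := Unitary.mul_star_self_of_mem hU
    simp only [sub_mul, mul_sub, mul_assoc, this, mul_one, one_mul]
    abel
  rw [h, CStarRing.norm_mul_mem_unitary _ (Unitary.star_mem hU)]
  have h1 := norm_sub_le ((U - 1) * F) (F * (U - 1))
  have h2 := norm_mul_le (U - 1) F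
  have h3 := norm_mul_le F (U - 1)
  linarith

theorem stmt6 {H : Type*} [NormedAddCommGroup H] [InnerProductSpace ℂ H] [CompleteSpace H] :
    ∀ ε > (0 : ℝ), ∃ η > (0 : ℝ), ∀ T : H →L[ℂ] H, (IsCompactOperator (⇑T) ∧ adjoint T = T) → ‖T‖ = 1 →
      ∀ x₀ : H, ‖x₀‖ = 1 → ‖T x₀‖ > 1 - η →
      ∃ S : H →L[ℂ] H, (IsCompactOperator (⇑S) ∧ adjoint S = S) ∧ ‖S‖ = 1 ∧ ‖S x₀‖ = 1 ∧ ‖S - T‖ < ε := by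
  intro ε hε
  set m : ℝ := min ε 1 with hm
  have hm0 : 0 < m := lt_min hε one_pos
  have hm1 : m ≤ 1 := min_le_right _ _
  have hmε : m ≤ ε := min_le_left _ _
  refine ⟨m ^ 3 / 10000, by positivity, fun T ⟨hTc, hTa⟩ hTn x hx hTx => ?_⟩
  have hTs : IsSelfAdjoint T := isSelfAdjoint_iff'.2 hTa
  obtain ⟨F, hFs, hFn, hFT, hTF, h0, B, hB⟩ :=
    hTs.exists_clamp hTn.le (r := 1 - m / 2) (by linarith) (by linarith)
  obtain ⟨y, hyz, hFy, hTx'⟩ := exists_norm_clamp_apply_eq hTs hTn.le hFs hFn hTF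
    (r := 1 - m / 2) (by linarith) h0 x
  have hz : ‖x - y‖ < m / 32 := by
    have hm3 : m ^ 3 ≤ 1 := pow_le_one₀ hm0.le hm1
    have h1 : (1 - m ^ 3 / 10000) ^ 2 < ‖T x‖ ^ 2 := by
      gcongr
      linarith
    rw [hx] at hTx'
    have h2 : m / 2 * ‖x - y‖ ^ 2 ≤ (1 - (1 - m / 2) ^ 2) * ‖x - y‖ ^ 2 := by
      gcongr
      nlinarith
    have h3 : m * ‖x - y‖ ^ 2 < m * (m / 32) ^ 2 := by nlinarith [sq_nonneg (m ^ 3), pow_pos hm0 3]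
    exact lt_of_pow_lt_pow_left₀ 2 (by positivity) (lt_of_mul_lt_mul_left h3 hm0.le)
  have hy : 1 - ‖x - y‖ ≤ ‖y‖ := by
    have := norm_sub_norm_le x y
    linarith
  have hy0 : 0 < ‖y‖ := by linarith
  have hy1 : ‖y‖ ≤ 1 := by
    have h := norm_add_sq_eq_norm_sq_add_norm_sq_of_inner_eq_zero _ _ hyz
    rw [add_sub_cancel, hx] at h
    nlinarith [norm_nonneg (x - y)]
  set e : H := (‖y‖⁻¹ : ℝ) • y with he
  have he1 : ‖e‖ = 1 := by
    rw [he, norm_smul, norm_inv, norm_norm, inv_mul_cancel₀ hy0.ne']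
  have hFe : ‖F e‖ = 1 := by
    rw [he, ← Complex.coe_smul, map_smul, Complex.coe_smul, norm_smul, hFy, norm_inv, norm_norm,
      inv_mul_cancel₀ hy0.ne']
  have hxe : inner ℂ x e = (‖y‖ : ℂ) := by
    have h1 : inner ℂ x y = (‖y‖ : ℂ) ^ 2 := by
      have h : inner ℂ (x - y) y = 0 := inner_eq_zero_symm.1 hyz
      rw [inner_sub_left, sub_eq_zero] at h
      rw [h, inner_self_eq_norm_sq_to_K]
      simp
    have h2 : (‖y‖ : ℂ) ≠ 0 := by exact_mod_cast hy0.ne'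
    rw [he, ← Complex.coe_smul, inner_smul_right, h1]
    push_cast
    field_simp
  have hxe' : ‖x - e‖ ≤ 2 * ‖x - y‖ := by
    have h1 : y - e = (‖y‖ - 1) • e := by
      rw [sub_smul, one_smul, he, smul_smul, mul_inv_cancel₀ hy0.ne', one_smul]
    have h2 : ‖y - e‖ ≤ ‖x - y‖ := by
      rw [h1, norm_smul, he1, Real.norm_eq_abs, abs_of_nonpos (by linarith)]
      linarith
    have h3 := norm_sub_le_norm_sub_add_norm_sub x y e
    linarith
  obtain ⟨U, hU, hUe, hU1⟩ := exists_unitary_apply_eq hx he1 hy0.le hxe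
  have hUx : star U x = e := by
    rw [← hUe]
    exact DFunLike.congr_fun (Unitary.star_mul_self_of_mem hU) e
  have hUn (v : H) : ‖U v‖ = ‖v‖ := norm_map_of_mem_unitary hU v
  have hSx : ‖(U * F * star U) x‖ = 1 := by
    change ‖U (F (star U x))‖ = 1
    rw [hUx, hUn, hFe]
  refine ⟨U * F * star U, ⟨?_, ?_⟩, ?_, hSx, ?_⟩
  · rw [hB]
    exact ((hTc.comp_clm B).clm_comp U).comp_clm (star U)
  · exact isSelfAdjoint_iff'.1 (hFs.conjugate U)
  · refine le_antisymm ?_ ?_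
    · rwa [CStarRing.norm_mul_mem_unitary _ (Unitary.star_mem hU),
        CStarRing.norm_mem_unitary_mul _ hU]
    · have := (U * F * star U).le_opNorm x
      rwa [hSx, hx, mul_one] at this
  · have h1 := norm_unitary_conj_sub_le hU F
    have h2 := norm_sub_le_norm_sub_add_norm_sub (U * F * star U) F T
    have h3 : 2 * ‖F‖ * ‖U - 1‖ ≤ 2 * 1 * ‖U - 1‖ := by gcongr
    linarith
end

section
/- Every complex Hilbert space H has the Bishop-Phelps-Bollobás point property for anti-symmetric operators: for every ε > 0 there exists η > 0 such that whenever T is a bounded linear operator on H with T* = −T, ‖T‖ = 1, and x₀ ∈ H is a unit vector satisfying ‖T x₀‖ > 1 − η, there exists a bounded linear operator S on H with S* = −S, ‖S‖ = 1, ‖S x₀‖ = 1, and ‖S − T‖ < ε. -/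
open ContinuousLinearMap

theorem exists_cfc_perturbation {H : Type*} [NormedAddCommGroup H] [InnerProductSpace ℂ H]
    [CompleteSpace H] [Nontrivial H] {A : H →L[ℂ] H} (hA : IsSelfAdjoint A) (hA1 : ‖A‖ ≤ 1)
    {a : ℝ} (ha0 : 0 < a) (ha1 : a < 1) :
    ∃ B K : H →L[ℂ] H, IsSelfAdjoint B ∧ IsSelfAdjoint K ∧ ‖B‖ ≤ 1 ∧ ‖B - A‖ ≤ 1 - a ∧
      B * B * (1 - K) = 1 - K ∧ ∀ x, (1 - a ^ 2) * ‖K x‖ ^ 2 ≤ ‖x‖ ^ 2 - ‖A x‖ ^ 2 := by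
  have hc : 0 < 1 - a ^ 2 := by nlinarith
  have hspec : ∀ t ∈ spectrum ℝ A, |t| ≤ 1 := fun t ht =>
    (spectrum.norm_le_norm_of_mem ht).trans hA1
  obtain ⟨f, hf⟩ : ∃ f : ℝ → ℝ, ∀ t, f t = t / max a |t| := ⟨_, fun _ => rfl⟩
  obtain ⟨k, hk⟩ : ∃ k : ℝ → ℝ, ∀ t, k t = min 1 ((1 - t ^ 2) / (1 - a ^ 2)) :=
    ⟨_, fun _ => rfl⟩
  have hm : ∀ t : ℝ, 0 < max a |t| := fun t => lt_max_of_lt_left ha0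
  have hfc : Continuous f := by
    rw [funext hf]
    exact continuous_id.div (continuous_const.max continuous_abs) fun t => (hm t).ne'
  have hkc : Continuous k := by
    rw [funext hk]
    fun_prop
  have hB : IsSelfAdjoint (cfc f A) := cfc_predicate f A
  have hK : IsSelfAdjoint (cfc k A) := cfc_predicate k A
  refine ⟨cfc f A, cfc k A, hB, hK, ?_, ?_, ?_, ?_⟩
  · refine norm_cfc_le zero_le_one fun t _ => ?_
    rw [hf, Real.norm_eq_abs, abs_div, abs_of_pos (hm t), div_le_one (hm t)]
    exact le_max_right _ _
  · have : cfc f A - A = cfc (fun t => f t - t) A := by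
      rw [cfc_sub f (fun t => t) A, cfc_id' ℝ A]
    rw [this]
    refine norm_cfc_le (by linarith) fun t ht => ?_
    have h1 := hspec t ht
    have hle : max a |t| ≤ 1 := max_le ha1.le h1
    have : f t - t = t / max a |t| * (1 - max a |t|) := by
      rw [hf]
      have := (hm t).ne'
      field_simp
    rw [this, Real.norm_eq_abs, abs_mul, abs_div, abs_of_pos (hm t),
      abs_of_nonneg (sub_nonneg.2 hle)]
    have h2 : |t| / max a |t| ≤ 1 := (div_le_one (hm t)).2 (le_max_right _ _)
    have h3 : a ≤ max a |t| := le_max_left _ _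
    nlinarith
  · have h1 : (1 : H →L[ℂ] H) - cfc k A = cfc (fun t => 1 - k t) A := by
      rw [cfc_sub (fun _ => 1) k A, cfc_const_one ℝ A]
    rw [h1, ← cfc_mul f f A, ← cfc_mul (fun t => f t * f t) (fun t => 1 - k t) A]
    refine cfc_congr fun t _ => ?_
    simp only [hf, hk]
    rcases le_total |t| a with h | h
    · have : 1 ≤ (1 - t ^ 2) / (1 - a ^ 2) := by
        rw [one_le_div hc]
        have := sq_le_sq' (by linarith [abs_nonneg t]) h
        rw [sq_abs] at this
        linarith
      simp [min_eq_left this]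
    · have ht : |t| ≠ 0 := by linarith
      rw [max_eq_right h, div_mul_div_comm, ← abs_mul, abs_mul_self, div_self, one_mul]
      simpa using ht
  · intro x
    have h1 : cfc (fun t => (1 - t * t) - (1 - a ^ 2) * (k t * k t)) A =
        (1 - A * A) - (1 - a ^ 2) • (cfc k A * cfc k A) := by
      rw [cfc_sub (fun t => 1 - t * t) (fun t => (1 - a ^ 2) * (k t * k t)) A,
        cfc_const_mul (1 - a ^ 2) (fun t => k t * k t) A, cfc_mul k k A,
        cfc_sub (fun _ => 1) (fun t => t * t) A, cfc_const_one ℝ A,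
        cfc_mul (fun t => t) (fun t => t) A, cfc_id' ℝ A]
    have h2 : 0 ≤ cfc (fun t => (1 - t * t) - (1 - a ^ 2) * (k t * k t)) A := by
      refine cfc_nonneg fun t ht => ?_
      have h3 : t ^ 2 ≤ 1 := by rw [← sq_abs]; nlinarith [hspec t ht, abs_nonneg t]
      have h4 : 0 ≤ (1 - t ^ 2) / (1 - a ^ 2) := div_nonneg (by linarith) hc.le
      have h5 : 0 ≤ k t := by rw [hk]; exact le_min zero_le_one h4
      have h6 : k t ≤ 1 := by rw [hk]; exact min_le_left _ _
      have h7 : k t * (1 - a ^ 2) ≤ 1 - t ^ 2 := by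
        rw [hk]
        exact (le_div_iff₀ hc).1 (min_le_right _ _)
      nlinarith [mul_nonneg (mul_nonneg hc.le h5) (sub_nonneg.2 h6)]
    rw [h1, nonneg_iff_isPositive] at h2
    have h3 := h2.re_inner_nonneg_left x
    have key : ∀ C : H →L[ℂ] H, IsSelfAdjoint C → RCLike.re (inner ℂ (C (C x)) x) = ‖C x‖ ^ 2 := by
      intro C hC
      rw [show inner ℂ (C (C x)) x = inner ℂ (C x) (C x) from
        (isSelfAdjoint_iff_isSymmetric.1 hC) (C x) x, ← inner_self_eq_norm_sq (𝕜 := ℂ)]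
    have h4 : (1 - A * A - (1 - a ^ 2) • (cfc k A * cfc k A) : H →L[ℂ] H) x =
        x - A (A x) - ((1 - a ^ 2 : ℝ) : ℂ) • cfc k A (cfc k A x) := by
      rw [Complex.coe_smul]
      rfl
    rw [h4, inner_sub_left, inner_sub_left, inner_smul_left, Complex.conj_ofReal, map_sub, map_sub,
      key A hA, inner_self_eq_norm_sq, RCLike.re_to_complex, Complex.re_ofReal_mul,
      ← RCLike.re_to_complex, key _ hK] at h3
    linarith

theorem norm_normalize_sub_le {H : Type*} [NormedAddCommGroup H] [NormedSpace ℂ H]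
    {v y : H} (hy : ‖y‖ = 1) : ‖(((‖v‖⁻¹ : ℝ) : ℂ)) • v - y‖ ≤ 2 * ‖v - y‖ := by
  rcases eq_or_ne v 0 with rfl | hv
  · simp [hy]
  have h0 : ‖v‖ ≠ 0 := norm_ne_zero_iff.2 hv
  have h1 : ‖(((‖v‖⁻¹ : ℝ) : ℂ)) • v - v‖ ≤ ‖v - y‖ := by
    have : (((‖v‖⁻¹ : ℝ) : ℂ)) • v - v = (((‖v‖⁻¹ - 1 : ℝ) : ℂ)) • v := by
      push_cast; rw [sub_smul, one_smul]
    rw [this, norm_smul, Complex.norm_real, Real.norm_eq_abs, ← abs_norm v, ← abs_mul, sub_mul,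
      abs_norm, inv_mul_cancel₀ h0, one_mul, ← hy, norm_sub_rev v y]
    exact abs_norm_sub_norm_le _ _
  calc _ = ‖((((‖v‖⁻¹ : ℝ) : ℂ)) • v - v) + (v - y)‖ := by congr 1; abel
    _ ≤ _ := (norm_add_le _ _).trans (by linarith)

open Submodule in
theorem exists_linearIsometryEquiv_apply_eq {H : Type*} [NormedAddCommGroup H]
    [InnerProductSpace ℂ H] {x y : H} (hx : ‖x‖ = 1) (hy : ‖y‖ = 1)
    (him : (inner ℂ x y).im = 0) (hxy : x + y ≠ 0) :
    ∃ U : H ≃ₗᵢ[ℂ] H, U y = x ∧ ∀ z, ‖U z - z‖ ≤ 4 * ‖x - y‖ * ‖z‖ := by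
  set n : ℝ := ‖x + y‖ with hn
  have hn0 : n ≠ 0 := norm_ne_zero_iff.2 hxy
  set w : H := ((n⁻¹ : ℝ) : ℂ) • (x + y) with hw
  have hw1 : ‖w‖ = 1 := by
    rw [hw, norm_smul, Complex.norm_real, norm_inv, Real.norm_eq_abs, hn, abs_norm,
      inv_mul_cancel₀ hn0]
  have hwy : ‖w - y‖ ≤ ‖x - y‖ := by
    have h := norm_normalize_sub_le (v := (2⁻¹ : ℂ) • (x + y)) hy
    have e1 : (((‖(2⁻¹ : ℂ) • (x + y)‖⁻¹ : ℝ) : ℂ)) • (2⁻¹ : ℂ) • (x + y) = w := by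
      rw [norm_smul, smul_smul, hw]
      congr 1
      rw [hn]
      push_cast
      norm_num
      ring
    have e2 : (2⁻¹ : ℂ) • (x + y) - y = (2⁻¹ : ℂ) • (x - y) := by module
    rw [e1, e2, norm_smul] at h
    norm_num at h
    linarith
  have hr : ∀ v : H, ‖v‖ = 1 → ∀ z, (ℂ ∙ v).reflection z = (2 * inner ℂ v z) • v - z := by
    intro v hv z
    rw [reflection_apply, starProjection_unit_singleton ℂ hv, mul_smul, two_smul, two_smul]
  refine ⟨(ℂ ∙ y).reflection.trans (ℂ ∙ w).reflection, ?_, fun z => ?_⟩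
  · have hyy : inner ℂ y y = (1 : ℂ) := by rw [inner_self_eq_norm_sq_to_K, hy]; simp
    have hre : inner ℂ x y = (((inner ℂ x y).re : ℝ) : ℂ) := Complex.ext rfl (by simpa using him)
    have hn2 : n ^ 2 = 2 + 2 * (inner ℂ x y).re := by
      rw [hn, norm_add_sq (𝕜 := ℂ), hx, hy]
      simp only [RCLike.re_to_complex]
      ring
    have hn2' : (n : ℂ) ^ 2 = 2 + 2 * inner ℂ x y := by
      rw [hre]
      exact_mod_cast hn2
    have hnC : (n : ℂ) ≠ 0 := by exact_mod_cast hn0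
    have hcoef : 2 * inner ℂ w y * ((n⁻¹ : ℝ) : ℂ) = 1 := by
      rw [hw, inner_smul_left, inner_add_left, hyy, Complex.conj_ofReal]
      push_cast
      field_simp
      rw [hn2']
      ring
    rw [LinearIsometryEquiv.trans_apply, reflection_mem_subspace_eq_self
      (mem_span_singleton_self y), hr w hw1]
    nth_rewrite 2 [hw]
    rw [smul_smul, hcoef, one_smul, add_sub_cancel_right]
  · obtain ⟨z, rfl⟩ := (ℂ ∙ y).reflection.surjective z
    have : ((ℂ ∙ y).reflection.trans (ℂ ∙ w).reflection) ((ℂ ∙ y).reflection z) -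
      (ℂ ∙ y).reflection z = (2 : ℂ) • (inner ℂ (w - y) z • w + inner ℂ y z • (w - y)) := by
      rw [LinearIsometryEquiv.trans_apply, reflection_reflection, hr w hw1, hr y hy, inner_sub_left]
      module
    rw [this, norm_smul, LinearIsometryEquiv.norm_map]
    have h1 : ‖inner ℂ (w - y) z • w‖ ≤ ‖w - y‖ * ‖z‖ := by
      rw [norm_smul, hw1, mul_one]; exact norm_inner_le_norm _ _
    have h2 : ‖inner ℂ y z • (w - y)‖ ≤ ‖w - y‖ * ‖z‖ := by
      rw [norm_smul, mul_comm]
      gcongr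
      simpa [hy] using norm_inner_le_norm (𝕜 := ℂ) y z
    have h3 := norm_add_le (inner ℂ (w - y) z • w) (inner ℂ y z • (w - y))
    have h4 := mul_le_mul_of_nonneg_right hwy (norm_nonneg z)
    rw [Complex.norm_ofNat]
    linarith

theorem exists_selfAdjoint_norm_attaining {H : Type*} [NormedAddCommGroup H]
    [InnerProductSpace ℂ H] [CompleteSpace H] {A : H →L[ℂ] H} (hA : IsSelfAdjoint A)
    (hA1 : ‖A‖ ≤ 1) {a d : ℝ} (ha0 : 0 < a) (ha1 : a < 1) (hd0 : 0 ≤ d) (hd1 : d < 1) {x : H}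
    (hx : ‖x‖ = 1) (hAx : 1 - ‖A x‖ ^ 2 ≤ (1 - a ^ 2) * d ^ 2) :
    ∃ S : H →L[ℂ] H, IsSelfAdjoint S ∧ ‖S‖ = 1 ∧ ‖S x‖ = 1 ∧
      ‖S - A‖ ≤ 16 * d + (1 - a) := by
  have hx0 : x ≠ 0 := norm_ne_zero_iff.1 (by simp [hx])
  have : Nontrivial H := ⟨x, 0, hx0⟩
  obtain ⟨B, K, hB, hK, hB1, hBA, hBK, hKA⟩ := exists_cfc_perturbation hA hA1 ha0 ha1
  have hc : 0 < 1 - a ^ 2 := by nlinarith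
  have hKx : ‖K x‖ ≤ d := by
    have h := hKA x
    rw [hx, one_pow] at h
    replace h := h.trans hAx
    exact (sq_le_sq₀ (norm_nonneg _) hd0).1 (le_of_mul_le_mul_left h hc)
  set v : H := x - K x with hv
  have hvx : ‖v - x‖ ≤ d := by rwa [hv, sub_sub_cancel_left, norm_neg]
  have hv0 : v ≠ 0 := by
    intro h
    rw [h, zero_sub, norm_neg, hx] at hvx
    linarith
  have hBv : B (B v) = v := by simpa [hv] using DFunLike.congr_fun hBK x
  set y : H := ((‖v‖⁻¹ : ℝ) : ℂ) • v with hy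
  have hy1 : ‖y‖ = 1 := by
    rw [hy, norm_smul, Complex.norm_real, norm_inv, norm_norm,
      inv_mul_cancel₀ (norm_ne_zero_iff.2 hv0)]
  have hyx : ‖x - y‖ ≤ 2 * d := by
    rw [norm_sub_rev]
    exact (norm_normalize_sub_le hx).trans (by linarith)
  have hBBy : B (B y) = y := by rw [hy, map_smul, map_smul, hBv]
  have hBy : ‖B y‖ = 1 := by
    have h1 := B.le_of_opNorm_le hB1 y
    have h2 := B.le_of_opNorm_le hB1 (B y)
    rw [hBBy] at h2
    linarith
  have him : (inner ℂ x y).im = 0 := by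
    have h1 : (inner ℂ x (K x)).im = 0 :=
      (isSelfAdjoint_iff_isSymmetric.1 hK).im_inner_self_apply x
    have h2 : (inner ℂ x x).im = 0 := inner_self_im (𝕜 := ℂ) x
    rw [hy, inner_smul_right, Complex.im_ofReal_mul, hv, inner_sub_right, Complex.sub_im, h1, h2,
      sub_zero, mul_zero]
  have hxy : x + y ≠ 0 := by
    intro h
    rw [eq_neg_of_add_eq_zero_right h, sub_neg_eq_add, ← two_smul ℂ, norm_smul, hx,
      Complex.norm_ofNat] at hyx
    linarith
  obtain ⟨U, hUy, hU⟩ := exists_linearIsometryEquiv_apply_eq hx hy1 him hxy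
  have hUx : U.symm x = y := by rw [← hUy, U.symm_apply_apply]
  set S : H →L[ℂ] H := (U : H →L[ℂ] H) ∘L B ∘L (U.symm : H →L[ℂ] H) with hS
  have hSa : ∀ z, S z = U (B (U.symm z)) := fun _ => rfl
  have hSx : ‖S x‖ = 1 := by rw [hSa, hUx, U.norm_map, hBy]
  have hS1 : ‖S‖ ≤ 1 := S.opNorm_le_bound zero_le_one fun z => by
    rw [hSa, U.norm_map, ← U.symm.norm_map z]
    exact B.le_of_opNorm_le hB1 _
  refine ⟨S, ?_, le_antisymm hS1 ?_, hSx, ?_⟩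
  · rw [isSelfAdjoint_iff_isSymmetric]
    intro z w
    change inner ℂ (U (B (U.symm z))) w = inner ℂ z (U (B (U.symm w)))
    rw [← U.symm.inner_map_map, ← U.symm.inner_map_map z, U.symm_apply_apply, U.symm_apply_apply]
    exact isSelfAdjoint_iff_isSymmetric.1 hB _ _
  · simpa [hSx, hx] using S.le_opNorm x
  · have hSB : ‖S - B‖ ≤ 16 * d := by
      refine opNorm_le_bound _ (by positivity) fun z => ?_
      obtain ⟨z, rfl⟩ := U.surjective z
      have e : (S - B) (U z) = (U (B z) - B z) - B (U z - z) := by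
        rw [sub_apply, hSa, U.symm_apply_apply, map_sub]
        abel
      rw [e, U.norm_map]
      have h1 := hU (B z)
      have h2 := B.le_of_opNorm_le hB1 (U z - z)
      have h3 := hU z
      have h4 := B.le_of_opNorm_le hB1 z
      have h5 := norm_sub_le (U (B z) - B z) (B (U z - z))
      have h6 : ‖x - y‖ * ‖B z‖ ≤ 2 * d * ‖z‖ := by
        gcongr
        linarith
      have h7 : ‖x - y‖ * ‖z‖ ≤ 2 * d * ‖z‖ := by gcongr
      linarith
    calc ‖S - A‖ = ‖(S - B) + (B - A)‖ := by rw [sub_add_sub_cancel]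
      _ ≤ _ := (norm_add_le _ _).trans (add_le_add hSB hBA)

theorem stmt7 {H : Type*} [NormedAddCommGroup H] [InnerProductSpace ℂ H] [CompleteSpace H] :
    ∀ ε > (0 : ℝ), ∃ η > (0 : ℝ), ∀ T : H →L[ℂ] H, (adjoint T = -T) → ‖T‖ = 1 →
      ∀ x₀ : H, ‖x₀‖ = 1 → ‖T x₀‖ > 1 - η →
      ∃ S : H →L[ℂ] H, (adjoint S = -S) ∧ ‖S‖ = 1 ∧ ‖S x₀‖ = 1 ∧ ‖S - T‖ < ε := by
  intro ε hε
  obtain ⟨δ, hδ0, hδ1, hδε⟩ : ∃ δ : ℝ, 0 < δ ∧ δ < 1 ∧ 17 * δ < ε :=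
    ⟨min (1 / 2) (ε / 18), by positivity, (min_le_left _ _).trans_lt (by norm_num),
      by linarith [min_le_right (1 / 2) (ε / 18)]⟩
  have hc : 0 < 1 - (1 - δ) ^ 2 := by nlinarith
  refine ⟨(1 - (1 - δ) ^ 2) * δ ^ 2 / 2, by positivity, fun T hT hT1 x hx hTx => ?_⟩
  have hA : IsSelfAdjoint (Complex.I • T) := by
    rw [IsSelfAdjoint, star_smul, star_eq_adjoint, hT]
    simp
  have hAx : 1 - ‖(Complex.I • T) x‖ ^ 2 ≤ (1 - (1 - δ) ^ 2) * δ ^ 2 := by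
    rw [smul_apply, norm_smul, Complex.norm_I, one_mul]
    have h1 : ‖T x‖ ≤ 1 := by simpa [hx] using T.le_of_opNorm_le hT1.le x
    nlinarith [norm_nonneg (T x)]
  obtain ⟨S, hS, hS1, hSx, hST⟩ := exists_selfAdjoint_norm_attaining hA
    (by rw [norm_smul, hT1]; simp) (sub_pos.2 hδ1) (by linarith) hδ0.le hδ1 hx hAx
  refine ⟨-Complex.I • S, ?_, ?_, ?_, ?_⟩
  · rw [← star_eq_adjoint, star_smul, hS.star_eq]
    simp
  · rw [norm_smul, hS1]; simp
  · rw [smul_apply, norm_smul, hSx]; simp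
  · have e : -Complex.I • S - T = -Complex.I • (S - Complex.I • T) := by
      rw [smul_sub, smul_smul]
      simp
    rw [e, norm_smul, norm_neg, Complex.norm_I, one_mul]
    linarith
end

section
/- Every complex Hilbert space H has the Bishop-Phelps-Bollobás point property for compact operators: for every ε > 0 there exists η > 0 such that whenever T is a compact bounded linear operator on H with ‖T‖ = 1 and x₀ ∈ H is a unit vector satisfying ‖T x₀‖ > 1 − η, there exists a compact bounded linear operator S on H with ‖S‖ = 1, ‖S x₀‖ = 1, and ‖S − T‖ < ε. -/
open ContinuousLinearMap

open scoped InnerProductSpace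

section

variable {𝕜 E : Type*} [RCLike 𝕜] [NormedAddCommGroup E] [InnerProductSpace 𝕜 E]

theorem norm_add_smul_sq_of_inner_eq_zero {u w : E} (hu : ‖u‖ = 1) (h : ⟪u, w⟫_𝕜 = 0) (a : 𝕜) :
    ‖w + a • u‖ ^ 2 = ‖w‖ ^ 2 + ‖a‖ ^ 2 := by
  have := norm_add_sq_eq_norm_sq_add_norm_sq_of_inner_eq_zero w (a • u)
    (𝕜 := 𝕜) (by rw [inner_smul_right, inner_eq_zero_symm.1 h, mul_zero])
  rw [norm_smul, hu, mul_one] at this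
  simpa only [sq] using this

theorem inner_sub_inner_smul_eq_zero {u : E} (hu : ‖u‖ = 1) (x : E) :
    ⟪u, x - ⟪u, x⟫_𝕜 • u⟫_𝕜 = 0 := by
  rw [inner_sub_right, inner_smul_right, inner_self_eq_norm_sq_to_K, hu]
  simp

theorem norm_sub_inner_smul_sq_add {u : E} (hu : ‖u‖ = 1) (x : E) :
    ‖x - ⟪u, x⟫_𝕜 • u‖ ^ 2 + ‖⟪u, x⟫_𝕜‖ ^ 2 = ‖x‖ ^ 2 := by
  rw [← norm_add_smul_sq_of_inner_eq_zero hu (inner_sub_inner_smul_eq_zero hu x),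
    sub_add_cancel]

theorem isCompactOperator_smulRight (f : E →L[𝕜] 𝕜) (u : E) :
    IsCompactOperator (f.smulRight u) :=
  (isCompactOperator_of_locallyCompactSpace_dom f).clm_comp (toSpanSingleton 𝕜 u)

/-- If a contraction `T` sends the unit vector `x₀` to a multiple of the unit vector `u`, then
replacing the component of `T` along `u` by `⟪x₀, ·⟫` yields a contraction. -/
theorem norm_add_inner_smul_le {T : E →L[𝕜] E} (hT : ‖T‖ ≤ 1) {x₀ u : E} (hx₀ : ‖x₀‖ = 1)
    (hu : ‖u‖ = 1) {c : 𝕜} (hc : T x₀ = c • u) (x : E) :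
    ‖(T x - ⟪u, T x⟫_𝕜 • u) + ⟪x₀, x⟫_𝕜 • u‖ ≤ ‖x‖ := by
  set z := x - ⟪x₀, x⟫_𝕜 • x₀ with hz
  have hw : T x - ⟪u, T x⟫_𝕜 • u = T z - ⟪u, T z⟫_𝕜 • u := by
    have huu : ⟪u, u⟫_𝕜 = 1 := by simp [inner_self_eq_norm_sq_to_K, hu]
    simp only [hz, map_sub, map_smul, hc, inner_sub_right, inner_smul_right, huu]
    module
  have h₁ := norm_add_smul_sq_of_inner_eq_zero hu
    (inner_sub_inner_smul_eq_zero (𝕜 := 𝕜) hu (T x)) ⟪x₀, x⟫_𝕜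
  have h₂ := norm_sub_inner_smul_sq_add (𝕜 := 𝕜) hu (T z)
  have h₃ := norm_sub_inner_smul_sq_add (𝕜 := 𝕜) hx₀ x
  have h₄ : ‖T z‖ ^ 2 ≤ ‖z‖ ^ 2 := by
    gcongr
    simpa using T.le_of_opNorm_le hT z
  rw [hw] at h₁ ⊢
  refine le_of_pow_le_pow_left₀ two_ne_zero (norm_nonneg x) ?_
  linarith [sq_nonneg ‖⟪u, T z⟫_𝕜‖]

theorem norm_sub_adjoint_sq_le [CompleteSpace E] {T : E →L[𝕜] E} (hT : ‖T‖ ≤ 1) {x₀ u : E}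
    (hx₀ : ‖x₀‖ = 1) (hu : ‖u‖ = 1) {r : ℝ} (hr : T x₀ = (r : 𝕜) • u) :
    ‖x₀ - adjoint T u‖ ^ 2 ≤ 2 * (1 - r) := by
  have hn : ‖adjoint T u‖ ≤ 1 := by
    simpa [hu] using (adjoint T).le_of_opNorm_le ((adjoint.norm_map T).trans_le hT) u
  have hi : RCLike.re ⟪x₀, adjoint T u⟫_𝕜 = r := by
    rw [adjoint_inner_right, hr, inner_smul_left, inner_self_eq_norm_sq_to_K, hu]
    simp
  rw [norm_sub_sq (𝕜 := 𝕜), hi, hx₀]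
  nlinarith [norm_nonneg (adjoint T u)]

end

theorem stmt11 {H : Type*} [NormedAddCommGroup H] [InnerProductSpace ℂ H] [CompleteSpace H] :
    ∀ ε > (0 : ℝ), ∃ η > (0 : ℝ), ∀ T : H →L[ℂ] H, (IsCompactOperator (⇑T)) → ‖T‖ = 1 →
      ∀ x₀ : H, ‖x₀‖ = 1 → ‖T x₀‖ > 1 - η →
      ∃ S : H →L[ℂ] H, (IsCompactOperator (⇑S)) ∧ ‖S‖ = 1 ∧ ‖S x₀‖ = 1 ∧ ‖S - T‖ < ε := by
  intro ε hε
  refine ⟨min 1 (ε ^ 2 / 2), by positivity, fun T hTc hT x₀ hx₀ hη ↦ ?_⟩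
  have hpos : 0 < ‖T x₀‖ := by linarith [min_le_left 1 (ε ^ 2 / 2)]
  have hη' : 2 * (1 - ‖T x₀‖) < ε ^ 2 := by linarith [min_le_right 1 (ε ^ 2 / 2)]
  obtain ⟨u, hu, hTu⟩ : ∃ u : H, ‖u‖ = 1 ∧ T x₀ = ((‖T x₀‖ : ℝ) : ℂ) • u := by
    refine ⟨((‖T x₀‖ : ℝ) : ℂ)⁻¹ • T x₀, ?_, ?_⟩
    · rw [norm_smul, norm_inv, Complex.norm_real, norm_norm, inv_mul_cancel₀ hpos.ne']
    · rw [smul_inv_smul₀ (by exact_mod_cast hpos.ne')]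
  set R : H →L[ℂ] H := (innerSL ℂ (x₀ - adjoint T u)).smulRight u with hR
  have hS (x : H) : (T + R) x = (T x - ⟪u, T x⟫_ℂ • u) + ⟪x₀, x⟫_ℂ • u := by
    simp only [hR, add_apply, smulRight_apply, innerSL_apply_apply, inner_sub_left,
      adjoint_inner_left]
    module
  have hle : ‖T + R‖ ≤ 1 := opNorm_le_bound _ zero_le_one fun x ↦ by
    rw [hS, one_mul]
    exact norm_add_inner_smul_le hT.le hx₀ hu hTu x
  have hSx₀ : ‖(T + R) x₀‖ = 1 := by
    have huu : ⟪u, u⟫_ℂ = 1 := by simp [inner_self_eq_norm_sq_to_K, hu]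
    have hxx : ⟪x₀, x₀⟫_ℂ = 1 := by simp [inner_self_eq_norm_sq_to_K, hx₀]
    rw [hS, hTu, inner_smul_right, huu, hxx, mul_one, sub_self, zero_add, one_smul, hu]
  refine ⟨T + R, hTc.add (isCompactOperator_smulRight _ u), le_antisymm hle ?_, hSx₀, ?_⟩
  · simpa only [hSx₀, hx₀, mul_one] using (T + R).le_opNorm x₀
  · rw [add_sub_cancel_left, hR, norm_smulRight_apply, innerSL_apply_norm, hu, mul_one]
    exact lt_of_pow_lt_pow_left₀ 2 hε.le
      ((norm_sub_adjoint_sq_le hT.le hx₀ hu hTu).trans_lt hη')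
end
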